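/- Let 0 < T < +∞ and let u, v : [0,T]×ℝ³ → ℝ³ and p : [0,T]×ℝ³ → ℝ be C^∞ up to t = 0, with |v(t,x)| = 1 for all (t,x), solving the non-stationary simplified Ericksen–Leslie system ∂_t u − Δu + (u·∇)u + div(∇v ⊙ ∇v) + ∇p = 0, ∂_t v − Δv + (u·∇)v − |∇v|² v = 0, div u = 0 on [0,T]×ℝ³, with initial data u(0,·) = u₀ ∈ L²(ℝ³) satisfying div u₀ = 0, and v(0,·) = v₀ with ∇v₀ ∈ L²(ℝ³). Let 0 < γ < 3 ≤ p < +∞ with η(γ,p) = γ/p − 3/p + 2/3 ≤ 0. If u ∈ M^p_{γ,0}L^p(0,T), each component of ∇v belongs to M^p_γ L^p(0,T), and sup_{R≥1} R^{−γ} ∫₀ᵀ ∫_{B_R} |p|^{p/2} dx dt < +∞, then for every t ∈ [0,T] the global energy inequality holds: ∫_{ℝ³} |u(t,x)|² dx + 2 ∫₀ᵗ ∫_{ℝ³} |∇u(s,x)|² dx ds + ∫_{ℝ³} |∇v(t,x)|² dx ≤ ∫_{ℝ³} |u₀|² dx + ∫_{ℝ³} |∇v₀|² dx. -/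

import Mathlib

open MeasureTheory Filter Metric Real

noncomputable section

/-- Three-dimensional Euclidean space. -/
abbrev E3 : Type := EuclideanSpace ℝ (Fin 3)

/-- Partial derivative `∂_j f` of a scalar field. -/
def pd (j : Fin 3) (f : E3 → ℝ) (x : E3) : ℝ :=
  fderiv ℝ f x (EuclideanSpace.single j 1)

/-- Laplacian of a scalar field. -/
def lap (f : E3 → ℝ) (x : E3) : ℝ := ∑ j, pd j (pd j f) x

/-- The annulus `C(R/2, R)`. -/
def ann (R : ℝ) : Set E3 := {x : E3 | R / 2 < ‖x‖ ∧ ‖x‖ < R}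

/-- Euclidean length `|u(x)|` of a vector field. -/
def vecNorm (u : E3 → Fin 3 → ℝ) (x : E3) : ℝ := Real.sqrt (∑ i, (u x i) ^ 2)

/-- `|∇v|² = Σ_{i,k} (∂_i v_k)²`. -/
def gradSq (v : E3 → Fin 3 → ℝ) (x : E3) : ℝ :=
  ∑ i, ∑ k, (pd i (fun y => v y k) x) ^ 2

/-- The non-stationary simplified Ericksen–Leslie system on `[0,T] × ℝ³`:
`∂_t u − Δu + (u·∇)u + div(∇v ⊙ ∇v) + ∇p = 0`,
`∂_t v − Δv + (u·∇)v − |∇v|² v = 0`, `div u = 0`. -/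
def EvolEL (T : ℝ) (u : ℝ → E3 → Fin 3 → ℝ) (P : ℝ → E3 → ℝ)
    (v : ℝ → E3 → Fin 3 → ℝ) : Prop :=
  (∀ t ∈ Set.Icc (0 : ℝ) T, ∀ x : E3, ∀ i : Fin 3,
    deriv (fun s => u s x i) t - lap (fun y => u t y i) x
      + (∑ j, u t x j * pd j (fun y => u t y i) x)
      + (∑ j, ∑ k,
          pd j (fun y => pd i (fun z => v t z k) y * pd j (fun z => v t z k) y) x)
      + pd i (P t) x = 0) ∧
  (∀ t ∈ Set.Icc (0 : ℝ) T, ∀ x : E3, ∀ i : Fin 3,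
    deriv (fun s => v s x i) t - lap (fun y => v t y i) x
      + (∑ j, u t x j * pd j (fun y => v t y i) x)
      - gradSq (v t) x * v t x i = 0) ∧
  (∀ t ∈ Set.Icc (0 : ℝ) T, ∀ x : E3, ∑ j, pd j (fun y => u t y j) x = 0)

/-- Membership in the time–space local Morrey space `M^p_γ L^p(0,T)`. -/
def MemMorreyT (p γ T : ℝ) (f : ℝ → E3 → ℝ) : Prop :=
  (∀ R : ℝ, 0 < R → IntegrableOn (fun q : ℝ × E3 => |f q.1 q.2| ^ p)
      (Set.Icc 0 T ×ˢ ball (0 : E3) R) volume) ∧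
  ∃ C : ℝ, ∀ R : ℝ, 1 ≤ R →
    R ^ (-γ) * ∫ t in Set.Icc (0 : ℝ) T, ∫ x in ball (0 : E3) R, |f t x| ^ p ≤ C

/-- Membership in `M^p_{γ,0} L^p(0,T)`. -/
def MemMorreyT0 (p γ T : ℝ) (f : ℝ → E3 → ℝ) : Prop :=
  MemMorreyT p γ T f ∧
  Tendsto (fun R : ℝ =>
      R ^ (-γ) * ∫ t in Set.Icc (0 : ℝ) T, ∫ x in ann R, |f t x| ^ p)
    atTop (nhds 0)

lemma pd_add {f g : E3 → ℝ} (hf : Differentiable ℝ f) (hg : Differentiable ℝ g) (j : Fin 3)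
    (x : E3) : pd j (fun y => f y + g y) x = pd j f x + pd j g x := by
  simp only [pd]
  rw [fderiv_fun_add (hf x) (hg x)]; rfl

lemma pd_sub {f g : E3 → ℝ} (hf : Differentiable ℝ f) (hg : Differentiable ℝ g) (j : Fin 3)
    (x : E3) : pd j (fun y => f y - g y) x = pd j f x - pd j g x := by
  simp only [pd]
  rw [fderiv_fun_sub (hf x) (hg x)]; rfl

lemma pd_mul {f g : E3 → ℝ} (hf : Differentiable ℝ f) (hg : Differentiable ℝ g) (j : Fin 3)
    (x : E3) : pd j (fun y => f y * g y) x = f x * pd j g x + pd j f x * g x := by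
  simp only [pd]
  rw [fderiv_fun_mul (hf x) (hg x)]; simp; ring

lemma pd_sq {f : E3 → ℝ} (hf : Differentiable ℝ f) (j : Fin 3) (x : E3) :
    pd j (fun y => f y ^ 2) x = 2 * f x * pd j f x := by
  simp only [pow_two]; rw [pd_mul hf hf]; ring

lemma pd_const (c : ℝ) (j : Fin 3) (x : E3) : pd j (fun _ => c) x = 0 := by
  simp [pd]

lemma pd_div_const {f : E3 → ℝ} (hf : Differentiable ℝ f) (c : ℝ) (j : Fin 3) (x : E3) :
    pd j (fun y => f y / c) x = pd j f x / c := by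
  simp only [div_eq_mul_inv]
  rw [pd_mul hf (by fun_prop), pd_const]; ring

lemma pd_const_mul {f : E3 → ℝ} (hf : Differentiable ℝ f) (c : ℝ) (j : Fin 3) (x : E3) :
    pd j (fun y => c * f y) x = c * pd j f x := by
  rw [pd_mul (by fun_prop) hf, pd_const]; ring

lemma pd_sum {f : Fin 3 → E3 → ℝ} (hf : ∀ i, Differentiable ℝ (f i)) (j : Fin 3)
    (x : E3) : pd j (fun y => ∑ i, f i y) x = ∑ i, pd j (f i) x := by
  simp only [pd]
  rw [fderiv_fun_sum (fun i _ => hf i x)]; simp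

lemma contDiff_pd {f : E3 → ℝ} (hf : ContDiff ℝ (⊤ : ℕ∞) f) (j : Fin 3) :
    ContDiff ℝ (⊤ : ℕ∞) (pd j f) :=
  (hf.fderiv_right (m := (⊤ : ℕ∞)) (by simp)).clm_apply contDiff_const

lemma ContDiff.differentiableAt_of_smooth {F : Type*} [NormedAddCommGroup F] [NormedSpace ℝ F] {f : F → ℝ}
    (hf : ContDiff ℝ (⊤ : ℕ∞) f) : Differentiable ℝ f := hf.differentiable (by simp)

lemma pd_comm {f : E3 → ℝ} (hf : ContDiff ℝ (⊤ : ℕ∞) f) (i j : Fin 3) (x : E3) :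
    pd i (pd j f) x = pd j (pd i f) x := by
  have h := (hf.contDiffAt (x := x)).isSymmSndFDerivAt
    (by simp only [minSmoothness_of_isRCLikeNormedField]
        exact WithTop.coe_le_coe.2 (le_top : (2 : ℕ∞) ≤ ⊤))
  have hd : DifferentiableAt ℝ (fderiv ℝ f) x :=
    (hf.fderiv_right (m := (⊤ : ℕ∞)) (by simp)).differentiable (by simp) x
  have key : ∀ a b : Fin 3, pd a (pd b f) x = fderiv ℝ (fderiv ℝ f) x
      (EuclideanSpace.single a 1) (EuclideanSpace.single b 1) := by
    intro a b
    show fderiv ℝ (fun y => fderiv ℝ f y (EuclideanSpace.single b 1)) x _ = _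
    rw [fderiv_clm_apply hd (differentiableAt_const _)]
    simp
  rw [key, key]; exact h _ _

lemma hasCompactSupport_pd {f : E3 → ℝ} (hf : HasCompactSupport f) (j : Fin 3) :
    HasCompactSupport (pd j f) := hf.fderiv_apply ℝ _

lemma integral_mul_pd {f g : E3 → ℝ} (hf : ContDiff ℝ (⊤ : ℕ∞) f) (hc : HasCompactSupport f)
    (hg : ContDiff ℝ (⊤ : ℕ∞) g) (j : Fin 3) :
    ∫ x, f x * pd j g x = - ∫ x, pd j f x * g x := by
  refine integral_mul_fderiv_eq_neg_fderiv_mul_of_integrable ?_ ?_ ?_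
    (fun x _ => hf.differentiableAt_of_smooth x) (fun x _ => hg.differentiableAt_of_smooth x)
  · exact ((contDiff_pd hf j).continuous.mul hg.continuous).integrable_of_hasCompactSupport
      ((hasCompactSupport_pd hc j).mul_right)
  · exact (hf.continuous.mul (contDiff_pd hg j).continuous).integrable_of_hasCompactSupport
      (hc.mul_right)
  · exact (hf.continuous.mul hg.continuous).integrable_of_hasCompactSupport hc.mul_right

/-- The energy flux. -/
def fluxG (U V W : Fin 3 → E3 → ℝ) (P : E3 → ℝ) (j : Fin 3) (x : E3) : ℝ :=
  (∑ i, U i x * pd j (U i) x)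
    - ((∑ i, U i x ^ 2) / 2 + P x + (∑ i, ∑ k, pd i (V k) x ^ 2) / 2) * U j x
    + ∑ k, pd j (V k) x * W k x

/-- The tensor whose divergence is the diffusive part of the energy flux. -/
def fluxK (U V : Fin 3 → E3 → ℝ) (i j : Fin 3) (x : E3) : ℝ :=
  (if i = j then ((∑ l, U l x ^ 2) - ∑ l, ∑ k, pd l (V k) x ^ 2) / 2 else 0)
    + ∑ k, pd i (V k) x * pd j (V k) x

/-- The convective part of the energy flux. -/
def fluxH (U V : Fin 3 → E3 → ℝ) (P : E3 → ℝ) (j : Fin 3) (x : E3) : ℝ :=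
  ((∑ i, U i x ^ 2) / 2 + P x + (∑ i, ∑ k, pd i (V k) x ^ 2) / 2) * U j x
    + ∑ i, (∑ k, pd i (V k) x * pd j (V k) x) * U i x

lemma sum_pd_fluxG {U V W : Fin 3 → E3 → ℝ} {P : E3 → ℝ}
    (hU : ∀ i, ContDiff ℝ (⊤ : ℕ∞) (U i)) (hV : ∀ i, ContDiff ℝ (⊤ : ℕ∞) (V i))
    (hW : ∀ i, ContDiff ℝ (⊤ : ℕ∞) (W i)) (hP : ContDiff ℝ (⊤ : ℕ∞) P)
    (hdiv : ∀ x, ∑ j, pd j (U j) x = 0) (x : E3) :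
    ∑ j, pd j (fluxG U V W P j) x =
      (∑ i, ∑ j, pd j (U i) x ^ 2) + (∑ i, U i x * lap (U i) x)
      - (∑ j, U j x * ((∑ i, U i x * pd j (U i) x) + pd j P x
          + ∑ i, ∑ k, pd i (V k) x * pd j (pd i (V k)) x))
      + (∑ k, lap (V k) x * W k x) + ∑ j, ∑ k, pd j (V k) x * pd j (W k) x := by
  have dU := fun i => (hU i).differentiableAt_of_smooth
  have dU1 := fun i j => (contDiff_pd (hU i) j).differentiableAt_of_smooth
  have dV1 := fun i j => (contDiff_pd (hV i) j).differentiableAt_of_smooth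
  have dW := fun i => (hW i).differentiableAt_of_smooth
  have dP := hP.differentiableAt_of_smooth
  have hj : ∀ j, pd j (fluxG U V W P j) x =
      (∑ i, (U i x * pd j (pd j (U i)) x + pd j (U i) x * pd j (U i) x))
      - (((∑ i, U i x ^ 2) / 2 + P x + (∑ i, ∑ k, pd i (V k) x ^ 2) / 2) * pd j (U j) x
        + ((∑ i, 2 * U i x * pd j (U i) x) / 2 + pd j P x
          + (∑ i, ∑ k, 2 * pd i (V k) x * pd j (pd i (V k)) x) / 2) * U j x)
      + ∑ k, (pd j (V k) x * pd j (W k) x + pd j (pd j (V k)) x * W k x) := by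
    intro j
    unfold fluxG
    rw [pd_add (by fun_prop) (by fun_prop), pd_sub (by fun_prop) (by fun_prop),
      pd_mul (by fun_prop) (by fun_prop), pd_add (by fun_prop) (by fun_prop),
      pd_add (by fun_prop) (by fun_prop), pd_div_const (by fun_prop), pd_div_const (by fun_prop),
      pd_sum (by fun_prop), pd_sum (by fun_prop), pd_sum (by fun_prop), pd_sum (by fun_prop)]
    congr 1
    · congr 1
      · exact Finset.sum_congr rfl fun i _ => pd_mul (dU i) (dU1 i j) j x
      · congr 4
        · congr 1
          exact Finset.sum_congr rfl fun i _ => pd_sq (dU i) j x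
        · refine Finset.sum_congr rfl fun i _ => ?_
          rw [pd_sum (fun k => by fun_prop)]
          exact Finset.sum_congr rfl fun k _ => pd_sq (dV1 k i) j x
    · exact Finset.sum_congr rfl fun k _ => pd_mul (dV1 k j) (dW k) j x
  rw [Finset.sum_congr rfl fun j _ => hj j]
  have := hdiv x
  generalize (∑ i, U i x ^ 2) / 2 + P x + (∑ i, ∑ k, pd i (V k) x ^ 2) / 2 = S
  simp only [lap, Fin.sum_univ_three] at this ⊢
  linear_combination (-S) * this

lemma sum_pd_fluxK {U V : Fin 3 → E3 → ℝ}
    (hU : ∀ i, ContDiff ℝ (⊤ : ℕ∞) (U i)) (hV : ∀ i, ContDiff ℝ (⊤ : ℕ∞) (V i))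
    (j : Fin 3) (x : E3) :
    ∑ i, pd i (fluxK U V i j) x = (∑ l, U l x * pd j (U l) x)
      + ∑ k, lap (V k) x * pd j (V k) x := by
  have dU := fun i => (hU i).differentiableAt_of_smooth
  have dV1 := fun i j => (contDiff_pd (hV i) j).differentiableAt_of_smooth
  have hi : ∀ i, pd i (fluxK U V i j) x =
      (if i = j then ((∑ l, 2 * U l x * pd i (U l) x)
        - ∑ l, ∑ k, 2 * pd l (V k) x * pd l (pd i (V k)) x) / 2 else 0)
      + ∑ k, (pd i (V k) x * pd j (pd i (V k)) x + pd i (pd i (V k)) x * pd j (V k) x) := by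
    intro i
    unfold fluxK
    rw [pd_add (by split_ifs <;> fun_prop) (by fun_prop), pd_sum (by fun_prop)]
    congr 1
    · split_ifs with h
      · rw [pd_div_const (by fun_prop), pd_sub (by fun_prop) (by fun_prop),
          pd_sum (by fun_prop), pd_sum (by fun_prop)]
        congr 2
        · exact Finset.sum_congr rfl fun i _ => pd_sq (dU i) _ x
        · refine Finset.sum_congr rfl fun l _ => ?_
          rw [pd_sum (fun k => by fun_prop)]
          refine Finset.sum_congr rfl fun k _ => ?_
          rw [pd_sq (dV1 k l), pd_comm (hV k) i l]
      · exact pd_const _ _ _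
    · refine Finset.sum_congr rfl fun k _ => ?_
      rw [pd_mul (dV1 k i) (dV1 k j), pd_comm (hV k) i j]
  rw [Finset.sum_congr rfl fun i _ => hi i, Finset.sum_add_distrib, Finset.sum_ite_eq' Finset.univ j]
  have c : ∀ l k, pd l (pd j (V k)) x = pd j (pd l (V k)) x := fun l k => pd_comm (hV k) l j x
  simp only [c, lap, Fin.sum_univ_three, Finset.mem_univ, if_true]
  ring

/-- The energy flux is a second-order divergence minus the convective flux. -/
lemma fluxG_eq {U V W : Fin 3 → E3 → ℝ} {P : E3 → ℝ}
    (hU : ∀ i, ContDiff ℝ (⊤ : ℕ∞) (U i)) (hV : ∀ i, ContDiff ℝ (⊤ : ℕ∞) (V i))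
    {x : E3} (hVd : ∀ j, ∑ k, V k x * pd j (V k) x = 0)
    (hW : ∀ k, W k x - lap (V k) x + (∑ j, U j x * pd j (V k) x)
      - (∑ i, ∑ l, pd i (V l) x ^ 2) * V k x = 0) (j : Fin 3) :
    fluxG U V W P j x = (∑ i, pd i (fluxK U V i j) x) - fluxH U V P j x := by
  rw [sum_pd_fluxK hU hV]
  have h : ∀ k, W k x = lap (V k) x - (∑ j, U j x * pd j (V k) x)
      + (∑ i, ∑ l, pd i (V l) x ^ 2) * V k x := fun k => by linarith [hW k]
  have e : ∑ k, pd j (V k) x * W k x = (∑ k, lap (V k) x * pd j (V k) x)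
      - ∑ i, (∑ k, pd i (V k) x * pd j (V k) x) * U i x := by
    simp only [h]
    have := hVd j
    generalize (∑ i, ∑ l, pd i (V l) x ^ 2) = S
    simp only [Fin.sum_univ_three] at this ⊢
    linear_combination S * this
  simp only [fluxG, fluxH]
  rw [e]; ring

/-- Pointwise energy balance. -/
lemma sum_pd_fluxG_ge {U V W A : Fin 3 → E3 → ℝ} {P : E3 → ℝ}
    (hU : ∀ i, ContDiff ℝ (⊤ : ℕ∞) (U i)) (hV : ∀ i, ContDiff ℝ (⊤ : ℕ∞) (V i))
    (hWs : ∀ i, ContDiff ℝ (⊤ : ℕ∞) (W i)) (hP : ContDiff ℝ (⊤ : ℕ∞) P)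
    (hdiv : ∀ x, ∑ j, pd j (U j) x = 0) (x : E3)
    (hunit : ∑ k, V k x ^ 2 = 1)
    (hVl : ∑ k, V k x * lap (V k) x = - ∑ i, ∑ k, pd i (V k) x ^ 2)
    (hW : ∀ k, W k x - lap (V k) x + (∑ j, U j x * pd j (V k) x)
      - (∑ i, ∑ l, pd i (V l) x ^ 2) * V k x = 0)
    (hA : ∀ i, A i x - lap (U i) x + (∑ j, U j x * pd j (U i) x)
      + (∑ j, ∑ k, pd j (fun y => pd i (V k) y * pd j (V k) y) x) + pd i P x = 0) :
    (∑ i, U i x * A i x) + (∑ i, ∑ k, pd i (V k) x * pd i (W k) x)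
      + (∑ i, ∑ k, pd i (U k) x ^ 2) ≤ ∑ j, pd j (fluxG U V W P j) x := by
  rw [sum_pd_fluxG hU hV hWs hP hdiv]
  have dV1 := fun i j => (contDiff_pd (hV i) j).differentiableAt_of_smooth
  have hs : ∀ i, ∑ j, ∑ k, pd j (fun y => pd i (V k) y * pd j (V k) y) x
      = (∑ l, ∑ k, pd l (V k) x * pd i (pd l (V k)) x) + ∑ k, pd i (V k) x * lap (V k) x := by
    intro i
    have : ∀ j k, pd j (fun y => pd i (V k) y * pd j (V k) y) x
        = pd i (V k) x * pd j (pd j (V k)) x + pd i (pd j (V k)) x * pd j (V k) x := by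
      intro j k
      rw [pd_mul (dV1 k i) (dV1 k j), pd_comm (hV k) j i]
    simp only [this, lap, Fin.sum_univ_three]
    ring
  simp only [hs] at hA
  have hA' : ∑ i, U i x * A i x = (∑ i, U i x * lap (U i) x)
      - (∑ j, U j x * ((∑ i, U i x * pd j (U i) x) + pd j P x
          + ∑ i, ∑ k, pd i (V k) x * pd j (pd i (V k)) x))
      - ∑ i, U i x * ∑ k, pd i (V k) x * lap (V k) x := by
    have h : ∀ i, A i x = lap (U i) x - (∑ j, U j x * pd j (U i) x) - pd i P x
        - (∑ l, ∑ k, pd l (V k) x * pd i (pd l (V k)) x) - ∑ k, pd i (V k) x * lap (V k) x :=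
      fun i => by linarith [hA i]
    simp only [h]
    generalize hB : (fun i => ∑ l, ∑ k, pd l (V k) x * pd i (pd l (V k)) x) = B
    have hB' : ∀ i, ∑ l, ∑ k, pd l (V k) x * pd i (pd l (V k)) x = B i := fun i => by rw [← hB]
    simp only [hB']
    simp only [Fin.sum_univ_three]
    ring
  have hL : ∑ k, lap (V k) x * W k x = (∑ k, lap (V k) x ^ 2)
      - (∑ i, ∑ k, pd i (V k) x ^ 2) ^ 2 - ∑ i, U i x * ∑ k, pd i (V k) x * lap (V k) x := by
    have h : ∀ k, W k x = lap (V k) x - (∑ j, U j x * pd j (V k) x)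
        + (∑ i, ∑ l, pd i (V l) x ^ 2) * V k x := fun k => by linarith [hW k]
    simp only [h]
    generalize (∑ i, ∑ l, pd i (V l) x ^ 2) = S at *
    simp only [Fin.sum_univ_three] at hVl ⊢
    linear_combination S * hVl
  have hQ : (∑ i, ∑ k, pd i (V k) x ^ 2) ^ 2 ≤ ∑ k, lap (V k) x ^ 2 := by
    have := Finset.sum_mul_sq_le_sq_mul_sq Finset.univ (fun k => V k x) (fun k => lap (V k) x)
    rw [hVl, hunit] at this
    linarith
  rw [hA', hL, Finset.sum_comm (f := fun i k => pd i (U k) x ^ 2)]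
  linarith

lemma contDiff_fluxG {U V W : Fin 3 → E3 → ℝ} {P : E3 → ℝ}
    (hU : ∀ i, ContDiff ℝ (⊤ : ℕ∞) (U i)) (hV : ∀ i, ContDiff ℝ (⊤ : ℕ∞) (V i))
    (hW : ∀ i, ContDiff ℝ (⊤ : ℕ∞) (W i)) (hP : ContDiff ℝ (⊤ : ℕ∞) P) (j : Fin 3) :
    ContDiff ℝ (⊤ : ℕ∞) (fluxG U V W P j) := by
  have hU1 := fun i j => contDiff_pd (hU i) j
  have hV1 := fun i j => contDiff_pd (hV i) j
  unfold fluxG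
  fun_prop

lemma contDiff_fluxK {U V : Fin 3 → E3 → ℝ}
    (hU : ∀ i, ContDiff ℝ (⊤ : ℕ∞) (U i)) (hV : ∀ i, ContDiff ℝ (⊤ : ℕ∞) (V i)) (i j : Fin 3) :
    ContDiff ℝ (⊤ : ℕ∞) (fluxK U V i j) := by
  have hV1 := fun i j => contDiff_pd (hV i) j
  unfold fluxK
  split_ifs <;> fun_prop

lemma contDiff_fluxH {U V : Fin 3 → E3 → ℝ} {P : E3 → ℝ}
    (hU : ∀ i, ContDiff ℝ (⊤ : ℕ∞) (U i)) (hV : ∀ i, ContDiff ℝ (⊤ : ℕ∞) (V i))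
    (hP : ContDiff ℝ (⊤ : ℕ∞) P) (j : Fin 3) :
    ContDiff ℝ (⊤ : ℕ∞) (fluxH U V P j) := by
  have hV1 := fun i j => contDiff_pd (hV i) j
  unfold fluxH
  fun_prop

/-- The remainder in the localized energy inequality for the cutoff `φ`. -/
def cutoffErr (φ : E3 → ℝ) (U V : Fin 3 → E3 → ℝ) (P : E3 → ℝ) (x : E3) : ℝ :=
  ∑ j, ((∑ i, pd i (pd j φ) x * fluxK U V i j x) + pd j φ x * fluxH U V P j x)

lemma integral_mul_sum_pd_fluxG {U V W : Fin 3 → E3 → ℝ} {P φ : E3 → ℝ}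
    (hU : ∀ i, ContDiff ℝ (⊤ : ℕ∞) (U i)) (hV : ∀ i, ContDiff ℝ (⊤ : ℕ∞) (V i))
    (hWs : ∀ i, ContDiff ℝ (⊤ : ℕ∞) (W i)) (hP : ContDiff ℝ (⊤ : ℕ∞) P)
    (hφ : ContDiff ℝ (⊤ : ℕ∞) φ) (hc : HasCompactSupport φ)
    (hVd : ∀ x, ∀ j, ∑ k, V k x * pd j (V k) x = 0)
    (hW : ∀ x, ∀ k, W k x - lap (V k) x + (∑ j, U j x * pd j (V k) x)
      - (∑ i, ∑ l, pd i (V l) x ^ 2) * V k x = 0) :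
    ∫ x, φ x * ∑ j, pd j (fluxG U V W P j) x = ∫ x, cutoffErr φ U V P x := by
  have cG := fun j => contDiff_fluxG hU hV hWs hP j
  have cK := fun i j => contDiff_fluxK hU hV i j
  have cH := fun j => contDiff_fluxH hU hV hP j
  have c1 := fun j => contDiff_pd hφ j
  have c2 := fun i j => contDiff_pd (c1 j) i
  have s1 := fun j => hasCompactSupport_pd hc j
  have s2 := fun i j => hasCompactSupport_pd (s1 j) i
  have iK : ∀ i j, Integrable fun x => pd i (pd j φ) x * fluxK U V i j x := fun i j =>
    ((c2 i j).continuous.mul (cK i j).continuous).integrable_of_hasCompactSupport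
      (s2 i j).mul_right
  have iK1 : ∀ i j, Integrable fun x => pd j φ x * pd i (fluxK U V i j) x := fun i j =>
    ((c1 j).continuous.mul (contDiff_pd (cK i j) i).continuous).integrable_of_hasCompactSupport
      (s1 j).mul_right
  have iH : ∀ j, Integrable fun x => pd j φ x * fluxH U V P j x := fun j =>
    ((c1 j).continuous.mul (cH j).continuous).integrable_of_hasCompactSupport
      (s1 j).mul_right
  have iG : ∀ j, Integrable fun x => φ x * pd j (fluxG U V W P j) x := fun j =>
    (hφ.continuous.mul (contDiff_pd (cG j) j).continuous).integrable_of_hasCompactSupport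
      hc.mul_right
  have iKH : ∀ j, Integrable fun x =>
      (∑ i, pd i (pd j φ) x * fluxK U V i j x) + pd j φ x * fluxH U V P j x :=
    fun j => (integrable_finsetSum _ fun i _ => iK i j).add (iH j)
  simp only [cutoffErr, Finset.mul_sum]
  rw [integral_finsetSum _ fun j _ => iG j,
    integral_finsetSum _ fun j _ => iKH j]
  refine Finset.sum_congr rfl fun j _ => ?_
  rw [integral_mul_pd hφ hc (cG j), integral_add (integrable_finsetSum _ fun i _ => iK i j) (iH j),
    integral_finsetSum _ fun i _ => iK i j]
  have : ∀ x, pd j φ x * fluxG U V W P j x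
      = (∑ i, pd j φ x * pd i (fluxK U V i j) x) - pd j φ x * fluxH U V P j x := fun x => by
    rw [fluxG_eq hU hV (hVd x) (hW x) j, mul_sub, Finset.mul_sum]
  simp only [this]
  rw [integral_sub (integrable_finsetSum _ fun i _ => iK1 i j) (iH j),
    integral_finsetSum _ fun i _ => iK1 i j]
  have : ∀ i, ∫ x, pd j φ x * pd i (fluxK U V i j) x
      = - ∫ x, pd i (pd j φ) x * fluxK U V i j x := fun i =>
    integral_mul_pd (c1 j) (s1 j) (cK i j) i
  simp only [this, Finset.sum_neg_distrib]
  ring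

/-- Localized energy inequality at a fixed time. -/
lemma integral_cutoff_energy_le {U V W A : Fin 3 → E3 → ℝ} {P φ : E3 → ℝ}
    (hU : ∀ i, ContDiff ℝ (⊤ : ℕ∞) (U i)) (hV : ∀ i, ContDiff ℝ (⊤ : ℕ∞) (V i))
    (hWs : ∀ i, ContDiff ℝ (⊤ : ℕ∞) (W i)) (hAc : ∀ i, Continuous (A i))
    (hP : ContDiff ℝ (⊤ : ℕ∞) P)
    (hφ : ContDiff ℝ (⊤ : ℕ∞) φ) (hc : HasCompactSupport φ) (hφ0 : ∀ x, 0 ≤ φ x)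
    (hdiv : ∀ x, ∑ j, pd j (U j) x = 0)
    (hunit : ∀ x, ∑ k, V k x ^ 2 = 1)
    (hW : ∀ x, ∀ k, W k x - lap (V k) x + (∑ j, U j x * pd j (V k) x)
      - (∑ i, ∑ l, pd i (V l) x ^ 2) * V k x = 0)
    (hA : ∀ x, ∀ i, A i x - lap (U i) x + (∑ j, U j x * pd j (U i) x)
      + (∑ j, ∑ k, pd j (fun y => pd i (V k) y * pd j (V k) y) x) + pd i P x = 0) :
    ∫ x, φ x * ((∑ i, U i x * A i x) + (∑ i, ∑ k, pd i (V k) x * pd i (W k) x)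
      + (∑ i, ∑ k, pd i (U k) x ^ 2)) ≤ ∫ x, cutoffErr φ U V P x := by
  have dV := fun i => (hV i).differentiableAt_of_smooth
  have dV1 := fun i j => (contDiff_pd (hV i) j).differentiableAt_of_smooth
  have hVd : ∀ x, ∀ j, ∑ k, V k x * pd j (V k) x = 0 := by
    intro x j
    have h : pd j (fun y => ∑ k, V k y ^ 2) x = 0 := by
      simp only [hunit]; exact pd_const _ _ _
    rw [pd_sum (fun k => by fun_prop), Finset.sum_congr rfl fun k _ => pd_sq (dV k) j x] at h
    simp only [mul_assoc, ← Finset.mul_sum] at h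
    linarith
  have hVl : ∀ x, ∑ k, V k x * lap (V k) x = - ∑ i, ∑ k, pd i (V k) x ^ 2 := by
    intro x
    have h : ∀ j, ∑ k, (V k x * pd j (pd j (V k)) x + pd j (V k) x * pd j (V k) x) = 0 := by
      intro j
      have h : pd j (fun y => ∑ k, V k y * pd j (V k) y) x = 0 := by
        simp only [hVd]; exact pd_const _ _ _
      rw [pd_sum (fun k => by fun_prop)] at h
      rw [← h]
      exact Finset.sum_congr rfl fun k _ => (pd_mul (dV k) (dV1 k j) j x).symm
    have h0 := h 0
    have h1 := h 1
    have h2 := h 2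
    simp only [lap, Fin.sum_univ_three] at h0 h1 h2 ⊢
    linear_combination h0 + h1 + h2
  rw [← integral_mul_sum_pd_fluxG hU hV hWs hP hφ hc hVd hW]
  have cU := fun i => (hU i).continuous
  have cU1 := fun i j => (contDiff_pd (hU i) j).continuous
  have cV1 := fun i j => (contDiff_pd (hV i) j).continuous
  have cW1 := fun i j => (contDiff_pd (hWs i) j).continuous
  have cG := fun j => (contDiff_pd (contDiff_fluxG hU hV hWs hP j) j).continuous
  have cφ := hφ.continuous
  refine integral_mono ?_ ?_ fun x => mul_le_mul_of_nonneg_left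
    (sum_pd_fluxG_ge hU hV hWs hP hdiv x (hunit x) (hVl x) (hW x) (hA x)) (hφ0 x)
  · exact Continuous.integrable_of_hasCompactSupport (by fun_prop) hc.mul_right
  · exact Continuous.integrable_of_hasCompactSupport (by fun_prop) hc.mul_right

/-! ### Space-time functions -/

lemma contDiff_slice {f : ℝ × E3 → ℝ} (hf : ContDiff ℝ (⊤ : ℕ∞) f) (t : ℝ) :
    ContDiff ℝ (⊤ : ℕ∞) fun y => f (t, y) := hf.comp (contDiff_prodMk_right t)

lemma pd_slice {f : ℝ × E3 → ℝ} (hf : ContDiff ℝ (⊤ : ℕ∞) f) (j : Fin 3) (t : ℝ) (x : E3) :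
    pd j (fun y => f (t, y)) x = fderiv ℝ f (t, x) (0, EuclideanSpace.single j 1) := by
  have h := (hf.differentiableAt_of_smooth (t, x)).hasFDerivAt.comp x (hasFDerivAt_prodMk_right t x)
  show fderiv ℝ (f ∘ fun y => (t, y)) x _ = _
  rw [h.fderiv]; simp

lemma hasDerivAt_slice {f : ℝ × E3 → ℝ} (hf : ContDiff ℝ (⊤ : ℕ∞) f) (t : ℝ) (x : E3) :
    HasDerivAt (fun s => f (s, x)) (fderiv ℝ f (t, x) (1, 0)) t := by
  exact (hf.differentiableAt_of_smooth (t, x)).hasFDerivAt.comp_hasDerivAt t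
    ((hasDerivAt_id t).prodMk (hasDerivAt_const t x))

lemma contDiff_pd_slice {f : ℝ × E3 → ℝ} (hf : ContDiff ℝ (⊤ : ℕ∞) f) (j : Fin 3) :
    ContDiff ℝ (⊤ : ℕ∞) fun q : ℝ × E3 => pd j (fun y => f (q.1, y)) q.2 := by
  simp only [pd_slice hf]
  exact (hf.fderiv_right (m := (⊤ : ℕ∞)) (by simp)).clm_apply contDiff_const

lemma contDiff_deriv_slice {f : ℝ × E3 → ℝ} (hf : ContDiff ℝ (⊤ : ℕ∞) f) :
    ContDiff ℝ (⊤ : ℕ∞) fun q : ℝ × E3 => deriv (fun s => f (s, q.2)) q.1 := by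
  simp only [(hasDerivAt_slice hf _ _).deriv]
  exact (hf.fderiv_right (m := (⊤ : ℕ∞)) (by simp)).clm_apply contDiff_const

lemma deriv_pd_slice {f : ℝ × E3 → ℝ} (hf : ContDiff ℝ (⊤ : ℕ∞) f) (j : Fin 3) (t : ℝ) (x : E3) :
    deriv (fun s => pd j (fun y => f (s, y)) x) t
      = pd j (fun y => deriv (fun s => f (s, y)) t) x := by
  have h := (hf.contDiffAt (x := (t, x))).isSymmSndFDerivAt
    (by simp only [minSmoothness_of_isRCLikeNormedField]
        exact WithTop.coe_le_coe.2 (le_top : (2 : ℕ∞) ≤ ⊤))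
  have cd := hf.fderiv_right (m := (⊤ : ℕ∞)) (by simp)
  have hd : DifferentiableAt ℝ (fderiv ℝ f) (t, x) := cd.differentiable (by simp) _
  have key : ∀ w : ℝ × E3, ContDiff ℝ (⊤ : ℕ∞) fun q => fderiv ℝ f q w :=
    fun w => cd.clm_apply contDiff_const
  have key2 : ∀ w z : ℝ × E3, fderiv ℝ (fun q => fderiv ℝ f q w) (t, x) z =
      fderiv ℝ (fderiv ℝ f) (t, x) z w := by
    intro w z
    rw [fderiv_clm_apply hd (differentiableAt_const _)]
    simp
  simp only [pd_slice hf, (hasDerivAt_slice hf _ _).deriv]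
  rw [(hasDerivAt_slice (key _) t x).deriv, pd_slice (key _), key2, key2]
  exact h _ _

lemma integrable_slab {f : ℝ × E3 → ℝ} (hf : Continuous f) {R t : ℝ}
    (h0 : ∀ s x, R ≤ ‖x‖ → f (s, x) = 0) :
    Integrable f ((volume.restrict (Set.Icc 0 t)).prod volume) := by
  have h1 : IntegrableOn f (Set.Icc 0 t ×ˢ closedBall (0 : E3) R) volume :=
    hf.continuousOn.integrableOn_compact (isCompact_Icc.prod (isCompact_closedBall _ _))
  have h2 : IntegrableOn f (Set.Icc 0 t ×ˢ (Set.univ : Set E3)) volume := by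
    refine h1.of_forall_sdiff_eq_zero (measurableSet_Icc.prod MeasurableSet.univ) ?_
    rintro ⟨s, x⟩ ⟨⟨hs, -⟩, hx⟩
    refine h0 s x ?_
    by_contra hcon
    exact hx ⟨hs, by simpa using (not_le.1 hcon).le⟩
  rw [IntegrableOn, Measure.volume_eq_prod, ← Measure.prod_restrict, Measure.restrict_univ] at h2
  exact h2

/-- Space-time continuity of the remainder. -/
lemma continuous_cutoffErr_slab {u v : ℝ → E3 → Fin 3 → ℝ} {P : ℝ → E3 → ℝ} {φ : E3 → ℝ}
    (hu : ContDiff ℝ (⊤ : ℕ∞) (fun q : ℝ × E3 => u q.1 q.2))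
    (hv : ContDiff ℝ (⊤ : ℕ∞) (fun q : ℝ × E3 => v q.1 q.2))
    (hP : ContDiff ℝ (⊤ : ℕ∞) (fun q : ℝ × E3 => P q.1 q.2))
    (hφ : ContDiff ℝ (⊤ : ℕ∞) φ) :
    Continuous fun q : ℝ × E3 =>
      cutoffErr φ (fun i y => u q.1 y i) (fun i y => v q.1 y i) (P q.1) q.2 := by
  have cu : ∀ i, Continuous fun q : ℝ × E3 => u q.1 q.2 i :=
    fun i => (contDiff_pi.1 hu i).continuous
  have cv1 : ∀ i j, Continuous fun q : ℝ × E3 => pd j (fun y => v q.1 y i) q.2 :=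
    fun i j => (contDiff_pd_slice (contDiff_pi.1 hv i) j).continuous
  have cP := hP.continuous
  have c1 := fun j => (contDiff_pd hφ j).continuous
  have c2 := fun i j => (contDiff_pd (contDiff_pd hφ j) i).continuous
  have cK : ∀ i j, Continuous fun q : ℝ × E3 =>
      fluxK (fun i y => u q.1 y i) (fun i y => v q.1 y i) i j q.2 := by
    intro i j
    simp only [fluxK]
    split_ifs <;> fun_prop
  have cH : ∀ j, Continuous fun q : ℝ × E3 =>
      fluxH (fun i y => u q.1 y i) (fun i y => v q.1 y i) (P q.1) j q.2 := by
    intro j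
    simp only [fluxH]
    fun_prop
  simp only [cutoffErr]
  fun_prop

/-- Localized energy inequality on `[0,t]`. -/
lemma local_energy_inequality {u v : ℝ → E3 → Fin 3 → ℝ} {P : ℝ → E3 → ℝ} {T : ℝ}
    (hu : ContDiff ℝ (⊤ : ℕ∞) (fun q : ℝ × E3 => u q.1 q.2))
    (hv : ContDiff ℝ (⊤ : ℕ∞) (fun q : ℝ × E3 => v q.1 q.2))
    (hP : ContDiff ℝ (⊤ : ℕ∞) (fun q : ℝ × E3 => P q.1 q.2))
    (hunit : ∀ t ∈ Set.Icc (0 : ℝ) T, ∀ x : E3, ∑ i, (v t x i) ^ 2 = 1)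
    (hsol : EvolEL T u P v) {φ : E3 → ℝ} {R : ℝ}
    (hφ : ContDiff ℝ (⊤ : ℕ∞) φ) (hc : HasCompactSupport φ) (hφ0 : ∀ x, 0 ≤ φ x)
    (hφR : ∀ x, R ≤ ‖x‖ → φ x = 0) (hφ1 : ∀ j x, R ≤ ‖x‖ → pd j φ x = 0)
    (hφ2 : ∀ i j x, R ≤ ‖x‖ → pd i (pd j φ) x = 0) {t : ℝ} (ht : t ∈ Set.Icc (0 : ℝ) T) :
    (∫ x, φ x * ((∑ i, u t x i ^ 2) + gradSq (v t) x))
      + 2 * (∫ s in Set.Icc (0 : ℝ) t, ∫ x, φ x * gradSq (u s) x)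
    ≤ (∫ x, φ x * ((∑ i, u 0 x i ^ 2) + gradSq (v 0) x))
      + 2 * ∫ s in Set.Icc (0 : ℝ) t, ∫ x,
          cutoffErr φ (fun i y => u s y i) (fun i y => v s y i) (P s) x := by
  have su : ∀ i, ContDiff ℝ (⊤ : ℕ∞) fun q : ℝ × E3 => u q.1 q.2 i := contDiff_pi.1 hu
  have sv : ∀ i, ContDiff ℝ (⊤ : ℕ∞) fun q : ℝ × E3 => v q.1 q.2 i := contDiff_pi.1 hv
  have su1 : ∀ i j, ContDiff ℝ (⊤ : ℕ∞) fun q : ℝ × E3 => pd j (fun y => u q.1 y i) q.2 :=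
    fun i j => contDiff_pd_slice (su i) j
  have sv1 : ∀ i j, ContDiff ℝ (⊤ : ℕ∞) fun q : ℝ × E3 => pd j (fun y => v q.1 y i) q.2 :=
    fun i j => contDiff_pd_slice (sv i) j
  have cu1 := fun i j => (su1 i j).continuous
  have cφ := hφ.continuous
  set e : ℝ × E3 → ℝ := fun q => (∑ i, u q.1 q.2 i ^ 2)
    + ∑ i, ∑ k, pd i (fun y => v q.1 y k) q.2 ^ 2 with he
  have se : ContDiff ℝ (⊤ : ℕ∞) e := by fun_prop
  set g : ℝ × E3 → ℝ := fun q => deriv (fun s => e (s, q.2)) q.1 with hg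
  have cg : Continuous g := (contDiff_deriv_slice se).continuous
  have hge : ∀ s x, g (s, x) = 2 * ((∑ i, u s x i * deriv (fun s => u s x i) s)
      + ∑ i, ∑ k, pd i (fun y => v s y k) x * pd i (fun y => deriv (fun s => v s y k) s) x) := by
    intro s x
    have h1 : ∀ i, HasDerivAt (fun s => u s x i) (deriv (fun s => u s x i) s) s := fun i =>
      (hasDerivAt_slice (su i) s x).differentiableAt.hasDerivAt
    have h2 : ∀ i k, HasDerivAt (fun s => pd i (fun y => v s y k) x)
        (pd i (fun y => deriv (fun s => v s y k) s) x) s := fun i k => by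
      rw [← deriv_pd_slice (sv k) i s x]
      exact (hasDerivAt_slice (sv1 k i) s x).differentiableAt.hasDerivAt
    have h3 : HasDerivAt (fun s => e (s, x)) _ s :=
      (HasDerivAt.fun_sum (u := Finset.univ) fun i _ => (h1 i).fun_pow 2).fun_add
      (HasDerivAt.fun_sum (u := Finset.univ) fun i _ =>
        HasDerivAt.fun_sum (u := Finset.univ) fun k _ => (h2 i k).fun_pow 2)
    rw [hg]
    simp only
    rw [h3.deriv]
    simp only [mul_add, Finset.mul_sum]
    norm_num [mul_assoc]
  have hdg : ∀ s x, HasDerivAt (fun s => e (s, x)) (g (s, x)) s := fun s x =>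
    (hasDerivAt_slice se s x).differentiableAt.hasDerivAt
  clear_value e g
  have hftc : ∀ x, e (t, x) - e (0, x) = ∫ s in Set.Icc (0 : ℝ) t, g (s, x) := by
    intro x
    rw [integral_Icc_eq_integral_Ioc, ← intervalIntegral.integral_of_le ht.1]
    symm
    exact intervalIntegral.integral_eq_sub_of_hasDerivAt (f := fun s => e (s, x))
      (f' := fun s => g (s, x)) (fun s _ => hdg s x) (Continuous.intervalIntegrable (by fun_prop) _ _)
  have ig : Integrable (fun q : ℝ × E3 => φ q.2 * g q)
      ((volume.restrict (Set.Icc 0 t)).prod volume) :=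
    integrable_slab (R := R) (by fun_prop) fun s x hx => by simp [hφR x hx]
  have iu : Integrable (fun q : ℝ × E3 => φ q.2 * gradSq (u q.1) q.2)
      ((volume.restrict (Set.Icc 0 t)).prod volume) :=
    integrable_slab (R := R) (by simp only [gradSq]; fun_prop) fun s x hx => by simp [hφR x hx]
  have ierr : Integrable (fun q : ℝ × E3 =>
      cutoffErr φ (fun i y => u q.1 y i) (fun i y => v q.1 y i) (P q.1) q.2)
      ((volume.restrict (Set.Icc 0 t)).prod volume) :=
    integrable_slab (R := R) (continuous_cutoffErr_slab hu hv hP hφ) fun s x hx => by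
      simp [cutoffErr, hφ1 _ x hx, hφ2 _ _ x hx]
  have hslice : ∀ s, Integrable fun x => φ x * e (s, x) := fun s => by
    have := (contDiff_slice se s).continuous
    exact Continuous.integrable_of_hasCompactSupport (by fun_prop) hc.mul_right
  have hE : (∫ x, φ x * e (t, x)) - ∫ x, φ x * e (0, x)
      = ∫ s in Set.Icc (0 : ℝ) t, ∫ x, φ x * g (s, x) := by
    rw [← integral_sub (hslice t) (hslice 0)]
    simp only [← mul_sub, hftc, ← integral_const_mul]
    exact (integral_integral_swap (f := fun s x => φ x * g (s, x)) ig).symm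
  have hmono : ∫ s in Set.Icc (0 : ℝ) t, ((∫ x, φ x * g (s, x))
        + 2 * ∫ x, φ x * gradSq (u s) x)
      ≤ ∫ s in Set.Icc (0 : ℝ) t, 2 * ∫ x,
          cutoffErr φ (fun i y => u s y i) (fun i y => v s y i) (P s) x := by
    refine setIntegral_mono_on (ig.integral_prod_left.add (iu.integral_prod_left.const_mul 2))
      (ierr.integral_prod_left.const_mul 2) measurableSet_Icc fun s hs => ?_
    have hsT : s ∈ Set.Icc (0 : ℝ) T := ⟨hs.1, hs.2.trans ht.2⟩
    have key := integral_cutoff_energy_le (U := fun i y => u s y i) (V := fun i y => v s y i)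
      (W := fun i y => deriv (fun s => v s y i) s) (A := fun i y => deriv (fun s => u s y i) s)
      (P := P s) (fun i => contDiff_slice (su i) s)
      (fun i => contDiff_slice (sv i) s)
      (fun i => contDiff_slice (contDiff_deriv_slice (sv i)) s)
      (fun i => (contDiff_slice (contDiff_deriv_slice (su i)) s).continuous)
      (contDiff_slice hP s) hφ hc hφ0 (hsol.2.2 s hsT) (hunit s hsT)
      (fun x k => hsol.2.1 s hsT x k) (fun x i => hsol.1 s hsT x i)
    have cg' : Continuous fun x => g (s, x) := by fun_prop
    have cu' : Continuous fun x => gradSq (u s) x := by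
      have := fun i j => (contDiff_slice (su1 i j) s).continuous
      simp only [gradSq]; fun_prop
    have i1 : Integrable fun x => φ x * g (s, x) :=
      Continuous.integrable_of_hasCompactSupport (by fun_prop) hc.mul_right
    have i2 : Integrable fun x => φ x * gradSq (u s) x :=
      Continuous.integrable_of_hasCompactSupport (by fun_prop) hc.mul_right
    rw [← integral_const_mul, ← integral_add i1 (i2.const_mul 2)]
    refine le_trans (le_of_eq ?_) (mul_le_mul_of_nonneg_left key zero_le_two)
    rw [← integral_const_mul]
    congr 1
    ext x
    rw [hge, gradSq]
    ring
  rw [integral_add ig.integral_prod_left (iu.integral_prod_left.const_mul 2),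
    integral_const_mul, integral_const_mul, ← hE] at hmono
  simp only [he] at hmono
  simp only [gradSq] at hmono ⊢
  linarith

lemma pd_eq_zero_of_eventually_const {f : E3 → ℝ} {c : ℝ} {x : E3} (j : Fin 3)
    (h : f =ᶠ[nhds x] fun _ => c) : pd j f x = 0 := by
  rw [pd, h.fderiv_eq]; simp

lemma pd_comp_smul (f : E3 → ℝ) (c : ℝ) (j : Fin 3) (x : E3) :
    pd j (fun y => f (c • y)) x = c * pd j f (c • x) := by
  simp only [pd]
  rw [fderiv_comp_smul]; simp

/-- Cutoff functions adapted to the annuli `ann R`. -/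
lemma exists_cutoff : ∃ M : ℝ, 0 ≤ M ∧ ∀ R : ℝ, 0 < R → ∃ φ : E3 → ℝ,
    ContDiff ℝ (⊤ : ℕ∞) φ ∧ HasCompactSupport φ ∧ (∀ x, 0 ≤ φ x) ∧ (∀ x, φ x ≤ 1) ∧
    (∀ x, ‖x‖ ≤ R / 2 → φ x = 1) ∧ (∀ x, R ≤ ‖x‖ → φ x = 0) ∧
    (∀ j x, x ∉ ann R → pd j φ x = 0) ∧ (∀ i j x, x ∉ ann R → pd i (pd j φ) x = 0) ∧
    (∀ j x, |pd j φ x| ≤ M / R) ∧ (∀ i j x, |pd i (pd j φ) x| ≤ M / R ^ 2) := by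
  let χ : ContDiffBump (0 : E3) := ⟨2 / 3, 5 / 6, by norm_num, by norm_num⟩
  have cχ : ContDiff ℝ (⊤ : ℕ∞) χ := χ.contDiff
  have sχ : HasCompactSupport χ := χ.hasCompactSupport
  have c1 := fun j => contDiff_pd cχ j
  have c2 := fun i j => contDiff_pd (c1 j) i
  have s1 := fun j => hasCompactSupport_pd sχ j
  have s2 := fun i j => hasCompactSupport_pd (s1 j) i
  choose M1 hM1 using fun j => (s1 j).exists_bound_of_continuous (c1 j).continuous
  choose M2 hM2 using fun i j => (s2 i j).exists_bound_of_continuous (c2 i j).continuous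
  have z1 : ∀ j y, (‖y‖ < 2 / 3 ∨ 5 / 6 < ‖y‖) → pd j χ y = 0 := by
    rintro j y (hy | hy)
    · refine pd_eq_zero_of_eventually_const (c := 1) j ?_
      filter_upwards [isOpen_ball.mem_nhds (show y ∈ ball (0 : E3) (2 / 3) by simpa using hy)]
        with z hz
      exact χ.one_of_mem_closedBall (ball_subset_closedBall hz)
    · refine pd_eq_zero_of_eventually_const (c := 0) j ?_
      filter_upwards [(isOpen_lt continuous_const continuous_norm).mem_nhds hy] with z hz
      exact χ.zero_of_le_dist (by simpa using (le_of_lt hz : 5 / 6 ≤ ‖z‖))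
  have z2 : ∀ i j y, (‖y‖ < 2 / 3 ∨ 5 / 6 < ‖y‖) → pd i (pd j χ) y = 0 := by
    intro i j y hy
    refine pd_eq_zero_of_eventually_const (c := 0) i ?_
    have ho : IsOpen {y : E3 | ‖y‖ < 2 / 3 ∨ 5 / 6 < ‖y‖} :=
      (isOpen_lt continuous_norm continuous_const).union
        (isOpen_lt continuous_const continuous_norm)
    filter_upwards [ho.mem_nhds hy] with z hz using z1 j z hz
  have hout : ∀ R : ℝ, 0 < R → ∀ x, x ∉ ann R → (‖R⁻¹ • x‖ < 2 / 3 ∨ 5 / 6 < ‖R⁻¹ • x‖) := by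
    intro R hR x hx
    have hn : ‖R⁻¹ • x‖ = ‖x‖ / R := by
      rw [norm_smul, norm_inv, Real.norm_of_nonneg hR.le]; field_simp
    rw [hn]
    by_cases h : R / 2 < ‖x‖
    · right
      have : R ≤ ‖x‖ := by
        by_contra hc
        exact hx ⟨h, not_le.1 hc⟩
      rw [lt_div_iff₀ hR]; linarith
    · left
      rw [div_lt_iff₀ hR]; linarith
  set M := (∑ j, |M1 j|) + ∑ i, ∑ j, |M2 i j| with hM
  have hMn1 : 0 ≤ ∑ j, |M1 j| := Finset.sum_nonneg fun _ _ => abs_nonneg _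
  have hMn2 : 0 ≤ ∑ i, ∑ j, |M2 i j| :=
    Finset.sum_nonneg fun _ _ => Finset.sum_nonneg fun _ _ => abs_nonneg _
  have b1 : ∀ j y, |pd j χ y| ≤ M := fun j y => by
    have h := Finset.single_le_sum (f := fun j => |M1 j|) (fun _ _ => abs_nonneg _)
      (Finset.mem_univ j)
    have := hM1 j y
    rw [Real.norm_eq_abs] at this
    linarith [le_abs_self (M1 j)]
  have b2 : ∀ i j y, |pd i (pd j χ) y| ≤ M := fun i j y => by
    have h := Finset.single_le_sum (f := fun j => |M2 i j|) (fun _ _ => abs_nonneg _)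
      (Finset.mem_univ j)
    have h' := Finset.single_le_sum (f := fun i => ∑ j, |M2 i j|)
      (fun _ _ => Finset.sum_nonneg fun _ _ => abs_nonneg _) (Finset.mem_univ i)
    have := hM2 i j y
    rw [Real.norm_eq_abs] at this
    linarith [le_abs_self (M2 i j)]
  refine ⟨M, by positivity, fun R hR => ?_⟩
  have p1 : ∀ j, pd j (fun x => χ (R⁻¹ • x)) = fun x => R⁻¹ * pd j χ (R⁻¹ • x) := fun j =>
    funext fun x => pd_comp_smul χ R⁻¹ j x
  have p2 : ∀ i j x, pd i (pd j (fun x => χ (R⁻¹ • x))) x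
      = R⁻¹ * (R⁻¹ * pd i (pd j χ) (R⁻¹ • x)) := fun i j x => by
    have hd : Differentiable ℝ fun x : E3 => pd j χ (R⁻¹ • x) :=
      (c1 j).differentiableAt_of_smooth.comp (by fun_prop)
    rw [p1, pd_const_mul hd, pd_comp_smul]
  have hn : ∀ x : E3, ‖R⁻¹ • x‖ = ‖x‖ / R := fun x => by
    rw [norm_smul, norm_inv, Real.norm_of_nonneg hR.le]; field_simp
  have hz : ∀ x : E3, R ≤ ‖x‖ → χ (R⁻¹ • x) = 0 := fun x hx => by
    refine χ.zero_of_le_dist ?_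
    rw [dist_zero_right, hn, le_div_iff₀ hR]
    change 5 / 6 * R ≤ _
    linarith
  refine ⟨fun x => χ (R⁻¹ • x), cχ.comp (by fun_prop), ?_, fun x => χ.nonneg, fun x => χ.le_one,
    fun x hx => ?_, hz, fun j x hx => ?_, fun i j x hx => ?_, fun j x => ?_, fun i j x => ?_⟩
  · exact HasCompactSupport.intro (isCompact_closedBall (0 : E3) R) fun x hx =>
      hz x (by simpa using (not_le.1 fun h => hx (by simpa using h)).le)
  · refine χ.one_of_mem_closedBall ?_
    rw [mem_closedBall, dist_zero_right, hn, div_le_iff₀ hR]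
    change _ ≤ 2 / 3 * R
    linarith
  · rw [p1]; beta_reduce; rw [z1 j _ (hout R hR x hx), mul_zero]
  · rw [p2, z2 i j _ (hout R hR x hx), mul_zero, mul_zero]
  · rw [p1, abs_mul, abs_of_pos (inv_pos.2 hR), div_eq_inv_mul]
    exact mul_le_mul_of_nonneg_left (b1 j _) (inv_pos.2 hR).le
  · rw [p2, abs_mul, abs_mul, abs_of_pos (inv_pos.2 hR), ← mul_assoc, ← mul_inv, ← pow_two,
      div_eq_inv_mul]
    exact mul_le_mul_of_nonneg_left (b2 i j _) (by positivity)

lemma mul_sq_le_one_add_rpow {x y p : ℝ} (hx : 0 ≤ x) (hy : 0 ≤ y) (hp : 3 ≤ p) :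
    x * y ^ 2 ≤ 1 + x ^ p + y ^ p := by
  have hxp := rpow_nonneg hx p
  have hyp := rpow_nonneg hy p
  set m := max 1 (max x y)
  have h1 : 1 ≤ m := le_max_left _ _
  have hxm : x ≤ m := (le_max_left _ _).trans (le_max_right _ _)
  have hym : y ≤ m := (le_max_right _ _).trans (le_max_right _ _)
  have h3 : x * y ^ 2 ≤ m ^ p :=
    calc x * y ^ 2 ≤ m * m ^ 2 := by gcongr
      _ = m ^ (3 : ℝ) := by norm_cast; ring
      _ ≤ m ^ p := rpow_le_rpow_of_exponent_le h1 hp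
  have h4 : m ^ p ≤ 1 + x ^ p + y ^ p := by
    rcases max_choice 1 (max x y) with h | h
    · rw [show m = 1 from h, one_rpow]; linarith
    · rcases max_choice x y with h' | h'
      · rw [show m = x from h.trans h']; linarith
      · rw [show m = y from h.trans h']; linarith
  exact h3.trans h4

lemma sq_le_one_add_rpow {y p : ℝ} (hy : 0 ≤ y) (hp : 3 ≤ p) : y ^ 2 ≤ 1 + y ^ p := by
  rcases le_total y 1 with h | h
  · nlinarith [rpow_nonneg hy p]
  · calc y ^ 2 = y ^ (2 : ℝ) := by norm_cast
      _ ≤ y ^ p := rpow_le_rpow_of_exponent_le h (by linarith)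
      _ ≤ 1 + y ^ p := by linarith

lemma sq_le_scaled {m l L p : ℝ} (hm : 0 ≤ m) (hl : 0 < l) (hL : l ^ p * L = 1) (hp : 3 ≤ p) :
    m ^ 2 ≤ l ^ 2 * (1 + m ^ p * L) := by
  have h := sq_le_one_add_rpow (y := m / l) (by positivity) hp
  have hlp := rpow_pos_of_pos hl p
  have hL' : L = (l ^ p)⁻¹ := eq_inv_of_mul_eq_one_right hL
  rw [div_rpow hm hl.le, div_pow, div_le_iff₀ (by positivity)] at h
  rw [hL', ← div_eq_mul_inv]; linarith

lemma mul_sq_le_scaled {n m l L d p : ℝ} (hn : 0 ≤ n) (hm : 0 ≤ m) (hl : 0 < l) (hd : 0 < d)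
    (hL : l ^ p * L = 1) (hp : 3 ≤ p) :
    m ^ 2 * n ≤ d * l ^ 3 * (1 + n ^ p * (L / d ^ p) + m ^ p * L) := by
  have h := mul_sq_le_one_add_rpow (x := n / (d * l)) (y := m / l) (by positivity)
    (by positivity) hp
  have hlp := rpow_pos_of_pos hl p
  have hdp := rpow_pos_of_pos hd p
  have hL' : L = (l ^ p)⁻¹ := eq_inv_of_mul_eq_one_right hL
  rw [div_rpow hm hl.le, div_rpow hn (by positivity), mul_rpow hd.le hl.le] at h
  have e1 : n ^ p * (L / d ^ p) = n ^ p / (d ^ p * l ^ p) := by rw [hL']; field_simp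
  have e2 : m ^ p * L = m ^ p / l ^ p := by rw [hL', div_eq_mul_inv]
  rw [e1, e2]
  have e3 : m ^ 2 * n = d * l ^ 3 * (n / (d * l) * (m / l) ^ 2) := by field_simp
  rw [e3]
  exact mul_le_mul_of_nonneg_left h (by positivity)

lemma abs_cutoffErr_le {φ P : E3 → ℝ} {U V : Fin 3 → E3 → ℝ} {x : E3} {a b m n : ℝ}
    (hn : 0 ≤ n) (hnm : n ≤ m)
    (hU : ∑ i, U i x ^ 2 = n ^ 2) (hV : ∀ i k, |pd i (V k) x| ≤ m) (hP : |P x| ≤ m ^ 2)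
    (ha : ∀ j, |pd j φ x| ≤ a) (hb : ∀ i j, |pd i (pd j φ) x| ≤ b) :
    |cutoffErr φ U V P x| ≤ 72 * b * m ^ 2 + 45 * a * (m ^ 2 * n) := by
  have hm : 0 ≤ m := hn.trans hnm
  have hb0 : 0 ≤ b := (abs_nonneg _).trans (hb 0 0)
  have ha0 : 0 ≤ a := (abs_nonneg _).trans (ha 0)
  have hUi : ∀ i, |U i x| ≤ n := fun i => by
    refine abs_le_of_sq_le_sq ?_ hn
    rw [← hU]
    exact Finset.single_le_sum (f := fun i => U i x ^ 2) (fun _ _ => sq_nonneg _)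
      (Finset.mem_univ i)
  have hG0 : 0 ≤ ∑ i, ∑ k, pd i (V k) x ^ 2 :=
    Finset.sum_nonneg fun _ _ => Finset.sum_nonneg fun _ _ => sq_nonneg _
  have hG : ∑ i, ∑ k, pd i (V k) x ^ 2 ≤ 9 * m ^ 2 := by
    have : ∀ i k, pd i (V k) x ^ 2 ≤ m ^ 2 := fun i k => sq_le_sq' (abs_le.1 (hV i k)).1
      (abs_le.1 (hV i k)).2
    calc _ ≤ ∑ i : Fin 3, ∑ k : Fin 3, m ^ 2 :=
          Finset.sum_le_sum fun i _ => Finset.sum_le_sum fun k _ => this i k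
      _ = 9 * m ^ 2 := by simp; ring
  have hn2 : n ^ 2 ≤ m ^ 2 := by gcongr
  have hT : ∀ i j, |∑ k, pd i (V k) x * pd j (V k) x| ≤ 3 * m ^ 2 := fun i j =>
    calc _ ≤ ∑ k, |pd i (V k) x * pd j (V k) x| := Finset.abs_sum_le_sum_abs _ _
      _ ≤ ∑ k : Fin 3, m * m := Finset.sum_le_sum fun k _ => by
          rw [abs_mul]; exact mul_le_mul (hV i k) (hV j k) (abs_nonneg _) hm
      _ = 3 * m ^ 2 := by simp; ring
  have hK : ∀ i j, |fluxK U V i j x| ≤ 8 * m ^ 2 := fun i j => by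
    unfold fluxK
    refine (abs_add_le _ _).trans ?_
    have : |(if i = j then ((∑ l, U l x ^ 2) - ∑ l, ∑ k, pd l (V k) x ^ 2) / 2 else 0)|
        ≤ 5 * m ^ 2 := by
      split_ifs
      · rw [abs_le, hU]; constructor <;> nlinarith [sq_nonneg n]
      · simp; positivity
    linarith [hT i j]
  have hH : ∀ j, |fluxH U V P j x| ≤ 15 * (m ^ 2 * n) := fun j => by
    unfold fluxH
    refine (abs_add_le _ _).trans ?_
    have h1 : |((∑ i, U i x ^ 2) / 2 + P x + (∑ i, ∑ k, pd i (V k) x ^ 2) / 2) * U j x|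
        ≤ (6 * m ^ 2) * n := by
      rw [abs_mul]
      refine mul_le_mul ?_ (hUi j) (abs_nonneg _) (by positivity)
      have := abs_le.1 hP
      rw [abs_le, hU]; constructor <;> nlinarith [sq_nonneg n]
    have h2 : |∑ i, (∑ k, pd i (V k) x * pd j (V k) x) * U i x| ≤ 9 * m ^ 2 * n :=
      calc _ ≤ ∑ i, |(∑ k, pd i (V k) x * pd j (V k) x) * U i x| := Finset.abs_sum_le_sum_abs _ _
        _ ≤ ∑ i : Fin 3, (3 * m ^ 2) * n := Finset.sum_le_sum fun i _ => by
            rw [abs_mul]; exact mul_le_mul (hT i j) (hUi i) (abs_nonneg _) (by positivity)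
        _ = 9 * m ^ 2 * n := by simp; ring
    linarith
  calc |cutoffErr φ U V P x|
      ≤ ∑ j, |(∑ i, pd i (pd j φ) x * fluxK U V i j x) + pd j φ x * fluxH U V P j x| :=
        Finset.abs_sum_le_sum_abs _ _
    _ ≤ ∑ j : Fin 3, ((∑ i : Fin 3, b * (8 * m ^ 2)) + a * (15 * (m ^ 2 * n))) := by
        refine Finset.sum_le_sum fun j _ => (abs_add_le _ _).trans (add_le_add ?_ ?_)
        · refine (Finset.abs_sum_le_sum_abs _ _).trans (Finset.sum_le_sum fun i _ => ?_)
          rw [abs_mul]; exact mul_le_mul (hb i j) (hK i j) (abs_nonneg _) hb0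
        · rw [abs_mul]; exact mul_le_mul (ha j) (hH j) (abs_nonneg _) ha0
    _ = _ := by simp; ring

lemma ann_subset_ball (R : ℝ) : ann R ⊆ ball (0 : E3) R := fun x hx => by simpa using hx.2

lemma Continuous.integrableOn_slab {f : ℝ × E3 → ℝ} (hf : Continuous f) (T R : ℝ) {s : Set E3}
    (hs : s ⊆ ball 0 R) : IntegrableOn f (Set.Icc 0 T ×ˢ s) (volume.prod volume) := by
  have h1 : IntegrableOn f (Set.Icc 0 T ×ˢ closedBall (0 : E3) R) volume :=
    hf.continuousOn.integrableOn_compact (isCompact_Icc.prod (isCompact_closedBall _ _))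
  exact h1.mono_set (Set.prod_mono le_rfl (hs.trans ball_subset_closedBall))

lemma setIntegral_slab_le {f : ℝ × E3 → ℝ} (hf : Continuous f) {T γ C R : ℝ} (hR : 1 ≤ R)
    (h : R ^ (-γ) * ∫ t in Set.Icc (0 : ℝ) T, ∫ x in ball (0 : E3) R, f (t, x) ≤ C) :
    ∫ q in Set.Icc (0 : ℝ) T ×ˢ ball (0 : E3) R, f q ∂(volume.prod volume) ≤ C * R ^ γ := by
  have hR0 : 0 < R := by linarith
  rw [setIntegral_prod _ (hf.integrableOn_slab T R le_rfl)]
  rw [rpow_neg hR0.le, inv_mul_le_iff₀ (rpow_pos_of_pos hR0 γ)] at h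
  linarith

lemma volume_slab_le {T R : ℝ} (hT : 0 ≤ T) (hR : 0 < R) :
    (volume.prod volume : Measure (ℝ × E3)).real (Set.Icc 0 T ×ˢ ann R)
      ≤ T * (volume : Measure E3).real (ball 0 1) * R ^ 3 := by
  rw [measureReal_prod_prod, Real.volume_real_Icc_of_le hT, sub_zero]
  have h : (volume : Measure E3).real (ann R) ≤ R ^ 3 * (volume : Measure E3).real (ball 0 1) := by
    refine (measureReal_mono (ann_subset_ball R) measure_ball_lt_top.ne).trans (le_of_eq ?_)
    rw [measureReal_def, Measure.addHaar_ball_of_pos _ _ hR, ENNReal.toReal_mul,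
      ENNReal.toReal_ofReal (by positivity), measureReal_def]
    simp
  calc _ ≤ T * (R ^ 3 * (volume : Measure E3).real (ball 0 1)) := by gcongr
    _ = _ := by ring

/-- Space-time integral of the remainder, bounded through the Morrey quantities. -/
lemma integral_cutoffErr_le {u v : ℝ → E3 → Fin 3 → ℝ} {P : ℝ → E3 → ℝ} {T γ p : ℝ} (hT : 0 < T)
    (hu : ContDiff ℝ (⊤ : ℕ∞) (fun q : ℝ × E3 => u q.1 q.2))
    (hv : ContDiff ℝ (⊤ : ℕ∞) (fun q : ℝ × E3 => v q.1 q.2))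
    (hP : ContDiff ℝ (⊤ : ℕ∞) (fun q : ℝ × E3 => P q.1 q.2))
    (hp3 : 3 ≤ p) (hη : γ / p - 3 / p + 2 / 3 ≤ 0)
    (hum : MemMorreyT p γ T (fun t x => vecNorm (u t) x))
    (hvm : ∀ i k : Fin 3, MemMorreyT p γ T (fun t x => pd i (fun y => v t y k) x))
    (hPm : ∃ C : ℝ, ∀ R : ℝ, 1 ≤ R →
      R ^ (-γ) * ∫ t in Set.Icc (0 : ℝ) T, ∫ x in ball (0 : E3) R, |P t x| ^ (p / 2) ≤ C)
    {M : ℝ} (hM : 0 ≤ M) :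
    ∃ B : ℝ, 0 ≤ B ∧ ∀ d : ℝ, 0 < d → ∀ R : ℝ, 1 ≤ R → ∀ φ : E3 → ℝ, ContDiff ℝ (⊤ : ℕ∞) φ →
      (∀ j x, x ∉ ann R → pd j φ x = 0) → (∀ i j x, x ∉ ann R → pd i (pd j φ) x = 0) →
      (∀ j x, |pd j φ x| ≤ M / R) → (∀ i j x, |pd i (pd j φ) x| ≤ M / R ^ 2) →
      ∀ t ∈ Set.Icc (0 : ℝ) T, ∫ s in Set.Icc (0 : ℝ) t, ∫ x,
          cutoffErr φ (fun i y => u s y i) (fun i y => v s y i) (P s) x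
        ≤ 72 * M * B * R ^ (-(1 / 3) : ℝ) + 45 * M * d * (B +
          (R ^ (-γ) * ∫ t in Set.Icc (0 : ℝ) T, ∫ x in ann R, |vecNorm (u t) x| ^ p) / d ^ p) := by
  have hp0 : 0 < p := by linarith
  have su : ∀ i, ContDiff ℝ (⊤ : ℕ∞) fun q : ℝ × E3 => u q.1 q.2 i := contDiff_pi.1 hu
  have cu := fun i => (su i).continuous
  have sv : ∀ i, ContDiff ℝ (⊤ : ℕ∞) fun q : ℝ × E3 => v q.1 q.2 i := contDiff_pi.1 hv
  have cv1 : ∀ i j, Continuous fun q : ℝ × E3 => pd j (fun y => v q.1 y i) q.2 :=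
    fun i j => (contDiff_pd_slice (sv i) j).continuous
  have cN : Continuous fun q : ℝ × E3 => vecNorm (u q.1) q.2 := by
    simp only [vecNorm]; fun_prop
  have cpow : ∀ {f : ℝ × E3 → ℝ} {r : ℝ}, Continuous f → 0 ≤ r →
      Continuous fun q => |f q| ^ r := fun hf hr => hf.abs.rpow_const fun _ => Or.inr hr
  have cNp : Continuous fun q : ℝ × E3 => |vecNorm (u q.1) q.2| ^ p := cpow cN hp0.le
  have cPp : Continuous fun q : ℝ × E3 => |P q.1 q.2| ^ (p / 2) :=
    cpow hP.continuous (by positivity)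
  have cVp : ∀ i k, Continuous fun q : ℝ × E3 => |pd i (fun y => v q.1 y k) q.2| ^ p :=
    fun i k => cpow (cv1 k i) hp0.le
  obtain ⟨Cu, hCu⟩ := hum.2
  choose Cv hCv using fun i k => (hvm i k).2
  obtain ⟨CP, hCP⟩ := hPm
  set S : ℝ × E3 → ℝ := fun q => (∑ i, ∑ k, |pd i (fun y => v q.1 y k) q.2| ^ p)
    + |P q.1 q.2| ^ (p / 2) + |vecNorm (u q.1) q.2| ^ p with hS
  have cS : Continuous S := by fun_prop
  have hVn : ∀ i k, ∀ q : ℝ × E3, 0 ≤ |pd i (fun y => v q.1 y k) q.2| ^ p :=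
    fun i k q => by positivity
  have hVs : ∀ q : ℝ × E3, 0 ≤ ∑ i, ∑ k, |pd i (fun y => v q.1 y k) q.2| ^ p :=
    fun q => by positivity
  have hPn : ∀ q : ℝ × E3, 0 ≤ |P q.1 q.2| ^ (p / 2) := fun q => by positivity
  have hNn : ∀ q : ℝ × E3, 0 ≤ |vecNorm (u q.1) q.2| ^ p := fun q => by positivity
  have hS0 : ∀ q, 0 ≤ S q := fun q => by have := hVs q; have := hPn q; have := hNn q; positivity
  set C := (∑ i, ∑ k, Cv i k) + CP + Cu with hC
  have hIS : ∀ R : ℝ, 1 ≤ R →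
      ∫ q in Set.Icc (0 : ℝ) T ×ˢ ball (0 : E3) R, S q ∂(volume.prod volume) ≤ C * R ^ γ := by
    intro R hR
    have iV := fun i k => (cVp i k).integrableOn_slab T R (s := ball 0 R) le_rfl
    have iP := cPp.integrableOn_slab T R (s := ball 0 R) le_rfl
    have iN := cNp.integrableOn_slab T R (s := ball 0 R) le_rfl
    have iVs := integrable_finsetSum Finset.univ fun i _ =>
      integrable_finsetSum Finset.univ fun k _ => iV i k
    have iVP : Integrable (fun q : ℝ × E3 => (∑ i, ∑ k, |pd i (fun y => v q.1 y k) q.2| ^ p)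
        + |P q.1 q.2| ^ (p / 2)) ((volume.prod volume).restrict (Set.Icc 0 T ×ˢ ball 0 R)) :=
      iVs.add iP
    rw [hS]
    beta_reduce
    rw [integral_add iVP iN, integral_add iVs iP,
      integral_finsetSum _ fun i _ => integrable_finsetSum Finset.univ fun k _ => iV i k]
    simp only [integral_finsetSum Finset.univ fun k _ => iV _ k]
    rw [hC, add_mul, add_mul, Finset.sum_mul]
    simp only [Finset.sum_mul]
    refine add_le_add (add_le_add (Finset.sum_le_sum fun i _ => Finset.sum_le_sum fun k _ => ?_)
      ?_) ?_
    · exact setIntegral_slab_le (cVp i k) hR (hCv i k R hR)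
    · exact setIntegral_slab_le cPp hR (hCP R hR)
    · exact setIntegral_slab_le cNp hR (hCu R hR)
  have hC0 : 0 ≤ C := by
    have h := hIS 1 le_rfl
    rw [one_rpow, mul_one] at h
    exact (integral_nonneg fun q => hS0 q).trans h
  set w := T * (volume : Measure E3).real (ball 0 1) with hw
  have hw0 : 0 ≤ w := by positivity
  refine ⟨w + C, by positivity, ?_⟩
  intro d hd R hR φ hφ h1 h2 b1 b2 t ht
  have hR0 : 0 < R := by linarith
  set l := R ^ ((γ - 3) / p) with hl
  set L := R ^ (3 - γ) with hL
  have hl0 : 0 < l := rpow_pos_of_pos hR0 _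
  have hL0 : 0 < L := rpow_pos_of_pos hR0 _
  have hdp : 0 < d ^ p := rpow_pos_of_pos hd p
  have hlL : l ^ p * L = 1 := by
    rw [hl, hL, ← rpow_mul hR0.le, div_mul_cancel₀ _ hp0.ne', ← rpow_add hR0]
    simp
  have hLγ : L * R ^ γ = R ^ 3 := by
    rw [hL, ← rpow_add hR0, sub_add_cancel]; norm_cast
  have hexp : (γ - 3) / p ≤ -(2 / 3) := by rw [sub_div]; linarith
  have hl2 : l ^ 2 * R ≤ R ^ (-(1 / 3) : ℝ) := by
    have : l ^ 2 * R = R ^ ((γ - 3) / p * 2 + 1) := by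
      rw [rpow_add hR0, rpow_one, rpow_mul hR0.le]; norm_cast
    rw [this]
    exact rpow_le_rpow_of_exponent_le hR (by linarith)
  have hl3 : l ^ 3 * R ^ 2 ≤ 1 := by
    have : l ^ 3 * R ^ 2 = R ^ ((γ - 3) / p * 3 + 2) := by
      rw [rpow_add hR0, rpow_mul hR0.le]; norm_cast
    rw [this]
    exact rpow_le_one_of_one_le_of_nonpos hR (by linarith)
  set c0 := 72 * (M / R ^ 2) * l ^ 2 with hc0
  set c1 := 45 * (M / R) * (d * l ^ 3) with hc1
  have hc00 : 0 ≤ c0 := by positivity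
  have hc10 : 0 ≤ c1 := by positivity
  set h : ℝ × E3 → ℝ := fun q => c0 * (1 + S q * L)
    + c1 * (1 + |vecNorm (u q.1) q.2| ^ p * (L / d ^ p) + S q * L) with hh
  have ch : Continuous h := by fun_prop
  have hh0 : ∀ q, 0 ≤ h q := fun q => by
    have := hS0 q; have := hNn q
    positivity
  have hpt : ∀ q : ℝ × E3,
      cutoffErr φ (fun i y => u q.1 y i) (fun i y => v q.1 y i) (P q.1) q.2 ≤ h q := by
    intro q
    have hroot : ∀ y : ℝ, 0 ≤ y → y ^ p ≤ S q → y ≤ S q ^ p⁻¹ := fun y hy hyS => by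
      have := rpow_le_rpow (rpow_nonneg hy p) hyS (inv_nonneg.2 hp0.le)
      rwa [rpow_rpow_inv hy hp0.ne'] at this
    have hmp : (S q ^ p⁻¹) ^ p = S q := rpow_inv_rpow (hS0 q) hp0.ne'
    have hm0 : 0 ≤ S q ^ p⁻¹ := rpow_nonneg (hS0 q) _
    have hN0 : 0 ≤ vecNorm (u q.1) q.2 := Real.sqrt_nonneg _
    have hNm : vecNorm (u q.1) q.2 ≤ S q ^ p⁻¹ := by
      refine hroot _ hN0 ?_
      have h3 := hVs q; have h4 := hPn q
      rw [← abs_of_nonneg hN0]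
      simp only [hS]; linarith
    have hVm : ∀ i k, |pd i (fun y => v q.1 y k) q.2| ≤ S q ^ p⁻¹ := fun i k => by
      refine hroot _ (abs_nonneg _) ?_
      have h3 := hPn q; have h4 := hNn q
      have h5 := Finset.single_le_sum
        (f := fun k => |pd i (fun y => v q.1 y k) q.2| ^ p) (fun k _ => hVn i k q)
        (Finset.mem_univ k)
      have h6 := Finset.single_le_sum
        (f := fun i => ∑ k, |pd i (fun y => v q.1 y k) q.2| ^ p)
        (fun i _ => Finset.sum_nonneg fun k _ => hVn i k q) (Finset.mem_univ i)
      simp only [hS]; linarith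
    have hPm : |P q.1 q.2| ≤ (S q ^ p⁻¹) ^ 2 := by
      have hs : √|P q.1 q.2| ≤ S q ^ p⁻¹ := by
        refine hroot _ (Real.sqrt_nonneg _) ?_
        have h3 := hVs q; have h4 := hNn q
        rw [sqrt_eq_rpow, ← rpow_mul (abs_nonneg _), one_div_mul_eq_div]
        simp only [hS]; linarith
      calc |P q.1 q.2| = √|P q.1 q.2| ^ 2 := (sq_sqrt (abs_nonneg _)).symm
        _ ≤ _ := by gcongr
    have hN2 : ∑ i, u q.1 q.2 i ^ 2 = vecNorm (u q.1) q.2 ^ 2 :=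
      (sq_sqrt (Finset.sum_nonneg fun _ _ => sq_nonneg _)).symm
    have key := abs_cutoffErr_le (φ := φ) (P := P q.1) (U := fun i y => u q.1 y i)
      (V := fun i y => v q.1 y i) (x := q.2) hN0 hNm hN2 hVm hPm (fun j => b1 j q.2)
      (fun i j => b2 i j q.2)
    have k2 := sq_le_scaled hm0 hl0 hlL hp3
    have k3 := mul_sq_le_scaled hN0 hm0 hl0 hd hlL hp3
    rw [hmp] at k2 k3
    refine (le_abs_self _).trans (key.trans ?_)
    rw [hh]
    simp only [abs_of_nonneg hN0]
    rw [hc0, hc1, mul_assoc _ (l ^ 2), mul_assoc (45 * (M / R))]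
    gcongr
  have hcerr := continuous_cutoffErr_slab hu hv hP hφ
  have herr0 : ∀ (s : ℝ) (x : E3), x ∉ ann R →
      cutoffErr φ (fun i y => u s y i) (fun i y => v s y i) (P s) x = 0 := fun s x hx => by
    simp [cutoffErr, h1 _ x hx, h2 _ _ x hx]
  have hsub := ann_subset_ball R
  have step1 : ∫ s in Set.Icc (0 : ℝ) t, ∫ x,
          cutoffErr φ (fun i y => u s y i) (fun i y => v s y i) (P s) x
      ≤ ∫ q in Set.Icc (0 : ℝ) T ×ˢ ann R, h q ∂(volume.prod volume) := by
    calc _ = ∫ s in Set.Icc (0 : ℝ) t, ∫ x in ann R,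
          cutoffErr φ (fun i y => u s y i) (fun i y => v s y i) (P s) x := by
            congr 1; ext s
            exact (setIntegral_eq_integral_of_forall_compl_eq_zero fun x hx =>
              herr0 s x hx).symm
      _ = ∫ q in Set.Icc (0 : ℝ) t ×ˢ ann R, cutoffErr φ (fun i y => u q.1 y i)
            (fun i y => v q.1 y i) (P q.1) q.2 ∂(volume.prod volume) :=
          (setIntegral_prod _ (hcerr.integrableOn_slab t R hsub)).symm
      _ ≤ ∫ q in Set.Icc (0 : ℝ) t ×ˢ ann R, h q ∂(volume.prod volume) :=
          integral_mono (hcerr.integrableOn_slab t R hsub) (ch.integrableOn_slab t R hsub) hpt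
      _ ≤ _ := setIntegral_mono_set (ch.integrableOn_slab T R hsub)
          (Eventually.of_forall hh0)
          (Set.prod_mono (Set.Icc_subset_Icc_right ht.2) le_rfl).eventuallyLE
  refine step1.trans ?_
  have iS := cS.integrableOn_slab T R hsub
  have iN := cNp.integrableOn_slab T R hsub
  have i1 := (continuous_const (y := (1 : ℝ))).integrableOn_slab T R hsub
  set IS := ∫ q in Set.Icc (0 : ℝ) T ×ˢ ann R, S q ∂(volume.prod volume) with hISdef
  have hISle : IS ≤ C * R ^ γ := by
    refine le_trans ?_ (hIS R hR)
    exact setIntegral_mono_set (cS.integrableOn_slab T R le_rfl) (Eventually.of_forall hS0)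
      (Set.prod_mono le_rfl hsub).eventuallyLE
  set ε := R ^ (-γ) * ∫ t in Set.Icc (0 : ℝ) T, ∫ x in ann R, |vecNorm (u t) x| ^ p with hε
  have hIN : ∫ q in Set.Icc (0 : ℝ) T ×ˢ ann R, |vecNorm (u q.1) q.2| ^ p ∂(volume.prod volume)
      = ε * R ^ γ := by
    rw [setIntegral_prod _ iN, hε, rpow_neg hR0.le]
    have := rpow_pos_of_pos hR0 γ
    field_simp
  have hε0 : 0 ≤ ε := mul_nonneg (rpow_nonneg hR0.le _)
    (integral_nonneg fun s => integral_nonneg fun x => hNn (s, x))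
  set A := ∫ _ in Set.Icc (0 : ℝ) T ×ˢ ann R, (1 : ℝ) ∂(volume.prod volume) with hA
  have hAle : A ≤ w * R ^ 3 := by
    rw [hA, setIntegral_const, smul_eq_mul, mul_one]
    exact volume_slab_le hT.le hR0
  have hint : ∫ q in Set.Icc (0 : ℝ) T ×ˢ ann R, h q ∂(volume.prod volume)
      = c0 * (A + IS * L) + c1 * (A + ε * R ^ γ * (L / d ^ p) + IS * L) := by
    set μ := (volume.prod volume : Measure (ℝ × E3)).restrict (Set.Icc (0 : ℝ) T ×ˢ ann R)
    have j1 : Integrable (fun q => 1 + S q * L) μ := Integrable.add i1 (Integrable.mul_const iS L)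
    have j2 : Integrable (fun q : ℝ × E3 => 1 + |vecNorm (u q.1) q.2| ^ p * (L / d ^ p)) μ :=
      Integrable.add i1 (Integrable.mul_const iN _)
    have j3 : Integrable
        (fun q : ℝ × E3 => 1 + |vecNorm (u q.1) q.2| ^ p * (L / d ^ p) + S q * L) μ :=
      j2.add (Integrable.mul_const iS L)
    rw [hh]
    beta_reduce
    rw [integral_add (j1.const_mul c0) (j3.const_mul c1),
      integral_const_mul, integral_const_mul, integral_add i1 (Integrable.mul_const iS L),
      integral_add j2 (Integrable.mul_const iS L), integral_add i1 (Integrable.mul_const iN _),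
      integral_mul_const, integral_mul_const, hIN]
  have hISL : IS * L ≤ C * R ^ 3 :=
    calc IS * L ≤ C * R ^ γ * L := by gcongr
      _ = C * R ^ 3 := by rw [← hLγ]; ring
  have hεL : ε * R ^ γ * (L / d ^ p) = ε / d ^ p * R ^ 3 := by rw [← hLγ]; ring
  rw [hint, hεL]
  calc c0 * (A + IS * L) + c1 * (A + ε / d ^ p * R ^ 3 + IS * L)
      ≤ c0 * (w * R ^ 3 + C * R ^ 3) + c1 * (w * R ^ 3 + ε / d ^ p * R ^ 3 + C * R ^ 3) := by
        gcongr
    _ = 72 * M * (w + C) * (l ^ 2 * R) + 45 * M * d * (w + C + ε / d ^ p) * (l ^ 3 * R ^ 2) := by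
        rw [hc0, hc1]; field_simp; ring
    _ ≤ 72 * M * (w + C) * R ^ (-(1 / 3) : ℝ) + 45 * M * d * (w + C + ε / d ^ p) * 1 := by
        gcongr
    _ = _ := by ring

lemma integrable_and_integral_le_of_exhaustion {f : E3 → ℝ} {g : ℝ × E3 → ℝ} (hf : Continuous f)
    (hg : Continuous g) (hf0 : ∀ x, 0 ≤ f x) (hg0 : ∀ q, 0 ≤ g q) {A t : ℝ}
    (h : ∀ η : ℝ, 0 < η → ∀ᶠ R in atTop, (∫ x in ball (0 : E3) (R / 2), f x)
      + 2 * (∫ q in Prod.snd ⁻¹' ball (0 : E3) (R / 2), g q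
          ∂((volume.restrict (Set.Icc (0 : ℝ) t)).prod volume)) ≤ A + η) :
    Integrable f ∧ Integrable g ((volume.restrict (Set.Icc (0 : ℝ) t)).prod volume) ∧
      (∫ x, f x) + 2 * ∫ q, g q ∂((volume.restrict (Set.Icc (0 : ℝ) t)).prod volume) ≤ A := by
  set μ := (volume.restrict (Set.Icc (0 : ℝ) t)).prod (volume : Measure E3) with hμ
  have hlim : Tendsto (fun R : ℝ => R / 2) atTop atTop := tendsto_id.atTop_div_const two_pos
  have cf : AECover (volume : Measure E3) atTop fun R : ℝ => ball (0 : E3) (R / 2) :=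
    aecover_ball hlim
  have cg : AECover μ atTop fun R : ℝ => Prod.snd ⁻¹' ball (0 : E3) (R / 2) :=
    { ae_eventually_mem := Eventually.of_forall fun q => by
        filter_upwards [hlim.eventually_gt_atTop ‖q.2‖] with R hR
        simpa using hR
      measurableSet := fun R => measurable_snd measurableSet_ball }
  have f0 : ∀ R : ℝ, 0 ≤ ∫ x in ball (0 : E3) (R / 2), f x := fun R => integral_nonneg hf0
  have g0 : ∀ R : ℝ, 0 ≤ ∫ q in Prod.snd ⁻¹' ball (0 : E3) (R / 2), g q ∂μ :=
    fun R => integral_nonneg hg0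
  have fi : ∀ R : ℝ, IntegrableOn f (ball (0 : E3) (R / 2)) := fun R =>
    (hf.continuousOn.integrableOn_compact (isCompact_closedBall _ _)).mono_set
      ball_subset_closedBall
  have gi : ∀ R : ℝ, IntegrableOn g (Prod.snd ⁻¹' ball (0 : E3) (R / 2)) μ := fun R => by
    have := hg.integrableOn_slab t (R / 2) (s := ball 0 (R / 2)) le_rfl
    rw [IntegrableOn, ← Set.univ_prod, hμ, ← Measure.prod_restrict, Measure.restrict_univ,
      Measure.prod_restrict]
    exact this
  have If : Integrable f := cf.integrable_of_integral_bounded_of_nonneg_ae (A + 1) fi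
    (Eventually.of_forall hf0) (by
      filter_upwards [h 1 one_pos] with R hR
      linarith [g0 R])
  have Ig : Integrable g μ := cg.integrable_of_integral_bounded_of_nonneg_ae (A + 1) gi
    (Eventually.of_forall hg0) (by
      filter_upwards [h 1 one_pos] with R hR
      linarith [f0 R, g0 R])
  refine ⟨If, Ig, le_of_forall_pos_le_add fun η hη => ?_⟩
  exact le_of_tendsto ((cf.integral_tendsto_of_countably_generated If).add
    ((cg.integral_tendsto_of_countably_generated Ig).const_mul 2)) (h η hη)

lemma exists_pos_mul_le {K δ : ℝ} (hK : 0 ≤ K) (hδ : 0 < δ) : ∃ d : ℝ, 0 < d ∧ K * d ≤ δ := by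
  refine ⟨δ / (K + 1), by positivity, ?_⟩
  rw [mul_div_assoc', div_le_iff₀ (by positivity)]
  nlinarith

lemma continuous_gradSq_slice {w : ℝ → E3 → Fin 3 → ℝ}
    (hw : ContDiff ℝ (⊤ : ℕ∞) (fun q : ℝ × E3 => w q.1 q.2)) :
    Continuous fun q : ℝ × E3 => gradSq (w q.1) q.2 := by
  have h : ∀ i j, Continuous fun q : ℝ × E3 => pd j (fun y => w q.1 y i) q.2 :=
    fun i j => (contDiff_pd_slice (contDiff_pi.1 hw i) j).continuous
  simp only [gradSq]
  fun_prop

lemma gradSq_nonneg (w : E3 → Fin 3 → ℝ) (x : E3) : 0 ≤ gradSq w x := by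
  unfold gradSq
  positivity

lemma setIntegral_ball_le_integral_cutoff {f φ : E3 → ℝ} {r : ℝ} (hf : Continuous f)
    (hf0 : ∀ x, 0 ≤ f x) (hφ : Continuous φ) (hφc : HasCompactSupport φ) (hφ0 : ∀ x, 0 ≤ φ x)
    (hφ1 : ∀ x, ‖x‖ ≤ r → φ x = 1) : ∫ x in ball (0 : E3) r, f x ≤ ∫ x, φ x * f x := by
  rw [setIntegral_congr_fun (g := fun x => φ x * f x) measurableSet_ball fun x hx => by
    simp [hφ1 x (by simpa using (mem_ball.1 hx).le)]]
  exact setIntegral_le_integral ((hφ.mul hf).integrable_of_hasCompactSupport hφc.mul_right)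
    (Eventually.of_forall fun x => mul_nonneg (hφ0 x) (hf0 x))

lemma setIntegral_slab_le_integral_cutoff {g : ℝ × E3 → ℝ} {φ : E3 → ℝ} {r R t : ℝ}
    (hg : Continuous g) (hg0 : ∀ q, 0 ≤ g q) (hφ : Continuous φ) (hφ0 : ∀ x, 0 ≤ φ x)
    (hφ1 : ∀ x, ‖x‖ ≤ r → φ x = 1) (hφR : ∀ x, R ≤ ‖x‖ → φ x = 0) :
    ∫ q in Prod.snd ⁻¹' ball (0 : E3) r, g q ∂((volume.restrict (Set.Icc (0 : ℝ) t)).prod volume)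
      ≤ ∫ s in Set.Icc (0 : ℝ) t, ∫ x, φ x * g (s, x) := by
  have hint : Integrable (fun q : ℝ × E3 => φ q.2 * g q)
      ((volume.restrict (Set.Icc (0 : ℝ) t)).prod volume) :=
    integrable_slab (R := R) (by fun_prop) fun s x hx => by simp [hφR x hx]
  rw [← integral_prod _ hint, setIntegral_congr_fun (g := fun q : ℝ × E3 => φ q.2 * g q)
    (measurable_snd measurableSet_ball) fun q hq => by
      simp [hφ1 q.2 (by simpa using (mem_ball.1 hq).le)]]
  exact setIntegral_le_integral hint
    (Eventually.of_forall fun q => mul_nonneg (hφ0 _) (hg0 _))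

theorem global_energy_inequality_EL
    (u v : ℝ → E3 → Fin 3 → ℝ) (P : ℝ → E3 → ℝ) (T γ p : ℝ) (hT : 0 < T)
    (hu : ContDiff ℝ (⊤ : ℕ∞) (fun q : ℝ × E3 => u q.1 q.2))
    (hv : ContDiff ℝ (⊤ : ℕ∞) (fun q : ℝ × E3 => v q.1 q.2))
    (hP : ContDiff ℝ (⊤ : ℕ∞) (fun q : ℝ × E3 => P q.1 q.2))
    (hunit : ∀ t ∈ Set.Icc (0 : ℝ) T, ∀ x : E3, ∑ i, (v t x i) ^ 2 = 1)
    (hsol : EvolEL T u P v)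
    (hγ0 : 0 < γ) (hγ3 : γ < 3) (hp3 : 3 ≤ p)
    (hη : γ / p - 3 / p + 2 / 3 ≤ 0)
    (hum : MemMorreyT0 p γ T (fun t x => vecNorm (u t) x))
    (hvm : ∀ i k : Fin 3, MemMorreyT p γ T (fun t x => pd i (fun y => v t y k) x))
    (hPm : ∃ C : ℝ, ∀ R : ℝ, 1 ≤ R →
      R ^ (-γ) * ∫ t in Set.Icc (0 : ℝ) T, ∫ x in ball (0 : E3) R, |P t x| ^ (p / 2) ≤ C)
    (hu0 : Integrable (fun x : E3 => ∑ i, (u 0 x i) ^ 2))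
    (hdiv0 : ∀ x : E3, ∑ j, pd j (fun y => u 0 y j) x = 0)
    (hv0 : Integrable (fun x : E3 => gradSq (v 0) x)) :
    ∀ t ∈ Set.Icc (0 : ℝ) T,
      (∫ x : E3, ∑ i, (u t x i) ^ 2)
        + 2 * (∫ s in Set.Icc (0 : ℝ) t, ∫ x : E3, gradSq (u s) x)
        + (∫ x : E3, gradSq (v t) x)
      ≤ (∫ x : E3, ∑ i, (u 0 x i) ^ 2) + ∫ x : E3, gradSq (v 0) x := by
  intro t ht
  have cu := fun i => (contDiff_pi.1 hu i).continuous
  have cG := continuous_gradSq_slice hu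
  have hG0 := gradSq_nonneg
  have cKt : Continuous fun x : E3 => ∑ i, u t x i ^ 2 :=
    continuous_finsetSum _ fun i _ => ((cu i).comp (Continuous.prodMk_right t)).pow 2
  have cDt : Continuous fun x : E3 => gradSq (v t) x :=
    (continuous_gradSq_slice hv).comp₂ continuous_const continuous_id
  have hK0 : ∀ s x, 0 ≤ ∑ i, u s x i ^ 2 := fun s x => by positivity
  have arith : ∀ {a a' b b' c e w z δ : ℝ}, a ≤ a' → b ≤ b' → a' + 2 * b' ≤ c + 2 * w → c ≤ e →
      w ≤ z → z < δ / 2 → a + 2 * b ≤ e + δ := by intros; linarith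
  obtain ⟨M, hM, hφ⟩ := exists_cutoff
  obtain ⟨B, hB, herr⟩ := integral_cutoffErr_le hT hu hv hP hp3 hη hum.1 hvm hPm hM
  set E₀ := (∫ x : E3, ∑ i, (u 0 x i) ^ 2) + ∫ x : E3, gradSq (v 0) x with hE
  obtain ⟨If, Ig, hle⟩ := integrable_and_integral_le_of_exhaustion (t := t) (A := E₀)
      (f := fun x => (∑ i, u t x i ^ 2) + gradSq (v t) x) (cKt.add cDt) cG
      (fun x => add_nonneg (hK0 t x) (hG0 _ x)) (fun q => hG0 _ _) (by
    intro δ hδ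
    obtain ⟨d, hd, hdδ⟩ := exists_pos_mul_le (mul_nonneg (mul_nonneg (by norm_num) hM) hB :
      0 ≤ 45 * M * B) (by linarith : 0 < δ / 4)
    rw [mul_right_comm] at hdδ
    have hlim : Tendsto (fun R : ℝ => 72 * M * B * R ^ (-(1 / 3) : ℝ) + 45 * M * d * (B +
          (R ^ (-γ) * ∫ t in Set.Icc (0 : ℝ) T, ∫ x in ann R, |vecNorm (u t) x| ^ p) / d ^ p))
        atTop (nhds (72 * M * B * 0 + 45 * M * d * (B + 0 / d ^ p))) :=
      ((tendsto_rpow_neg_atTop (by norm_num : (0 : ℝ) < 1 / 3)).const_mul _).add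
        (((hum.2.div_const _).const_add _).const_mul _)
    filter_upwards [hlim.eventually_lt_const (u := δ / 2) (by simp; linarith),
      eventually_ge_atTop 1] with R hRδ hR
    have hR0 : 0 < R := by linarith
    obtain ⟨φ, hφs, hφc, hφ0, hφ1, hφin, hφout, hφd1, hφd2, hb1, hb2⟩ := hφ R hR0
    have hout : ∀ x : E3, R ≤ ‖x‖ → x ∉ ann R := fun x hx hxa => hxa.2.not_ge hx
    have hloc := local_energy_inequality hu hv hP hunit hsol hφs hφc hφ0 hφout
      (fun j x hx => hφd1 j x (hout x hx)) (fun i j x hx => hφd2 i j x (hout x hx)) ht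
    have he := herr d hd R hR φ hφs hφd1 hφd2 hb1 hb2 t ht
    have h0 : ∫ x, φ x * ((∑ i, u 0 x i ^ 2) + gradSq (v 0) x) ≤ E₀ := by
      rw [hE, ← integral_add hu0 hv0]
      exact integral_mono_of_nonneg
        (Eventually.of_forall fun x => mul_nonneg (hφ0 x) (add_nonneg (hK0 0 x) (hG0 _ x)))
        (hu0.add hv0)
        (Eventually.of_forall fun x =>
          mul_le_of_le_one_left (add_nonneg (hK0 0 x) (hG0 _ x)) (hφ1 x))
    have cφ := hφs.continuous
    have hball := setIntegral_ball_le_integral_cutoff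
      (f := fun x => (∑ i, u t x i ^ 2) + gradSq (v t) x) (cKt.add cDt)
      (fun x => add_nonneg (hK0 t x) (hG0 _ x)) cφ hφc hφ0 hφin
    have hslab := setIntegral_slab_le_integral_cutoff (t := t) cG (fun q => hG0 _ _) cφ hφ0
      hφin hφout
    exact arith hball hslab hloc h0 he hRδ)
  have Iu : Integrable fun x : E3 => ∑ i, u t x i ^ 2 :=
    If.mono' cKt.aestronglyMeasurable (Eventually.of_forall fun x => by
      rw [norm_of_nonneg (hK0 t x)]; linarith [hG0 (v t) x])
  have Iv : Integrable fun x : E3 => gradSq (v t) x :=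
    If.mono' cDt.aestronglyMeasurable (Eventually.of_forall fun x => by
      rw [norm_of_nonneg (hG0 _ x)]; linarith [hK0 t x])
  rw [integral_add Iu Iv, integral_prod _ Ig] at hle
  rwa [add_right_comm]
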